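/- arXiv:2410.17904 — 8 statements merged into one kernel-verified Lean document; each statement's English description precedes it below -/
import Mathlib

section
/- Let M be a finite MDP over finite state space S and finite action space A with horizon H, transition kernels P_h : S × A → Δ(S), and mean rewards r_h : S × A → [0,1]. Suppose C_push > 0 and μ_h ∈ Δ(S) (h ∈ [H]) satisfy P_h(s'|s,a) ≤ C_push·μ_h(s') for all h, s, a, s'. Let F be a finite class of tuples f = (f_1,…,f_{H+1}) with f_h : S → [0,1]. Let W ∈ {±1}^{d×S} have independent Rademacher entries, and define ψ_h(s,a) = r_h(s,a) ⊕ (1/√d)·W·(P_h(·|s,a)/√(μ_h(·))) ∈ ℝ^{d+1} and w_{f,h} = 1 ⊕ (1/√d)·W·(√(μ_h(·))·f_{h+1}(·)) ∈ ℝ^{d+1}, with the convention that the coordinate P_h(s'|s,a)/√(μ_h(s')) equals 0 when μ_h(s') = 0. Then for any ε ∈ (0,1) and δ ∈ (0,1), if d ≥ 2^9·C_push·log(16·|F|·H/(δ·ε))/ε, then with probability at least 1−δ over the draw of W: (i) for every f ∈ F and h ∈ [H], Σ_{s∈S} Σ_{a∈A} μ_h(s)·(1/|A|)·( clip(⟨w_{f,h},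 ψ_h(s,a)⟩) − [T_h f_{h+1}](s,a) )² ≤ ε; (ii) max_{s,a,h} ‖ψ_h(s,a)‖₂² ≤ C_push·(16·log(|S|·|A|·H) + 11); and (iii) max_{f∈F, h∈[H]} ‖w_{f,h}‖₂² ≤ 16·log(|F|·H) + 11. -/
open Finset

attribute [local instance] Classical.propDecidable

/-- A Rademacher sign: `true ↦ +1`, `false ↦ -1`. -/
noncomputable def signVal (b : Bool) : ℝ := if b then 1 else -1

/-- Clipping operator `clip(x) = max(min(x,2),0)`. -/
noncomputable def clip (x : ℝ) : ℝ := max (min x 2) 0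

/-- Feature map `ψ_h(s,a) = r_h(s,a) ⊕ (1/√d)·W·(P_h(·|s,a)/√(μ_h(·))) ∈ ℝ^{d+1}`,
with the convention that the coordinate is `0` when `μ_h(s') = 0`. -/
noncomputable def psiFeat {S A : Type*} [Fintype S] (d : ℕ)
    (W : Fin d → S → Bool) (P : S → A → S → ℝ) (r : S → A → ℝ) (μ : S → ℝ)
    (s : S) (a : A) : Fin (d + 1) → ℝ :=
  Fin.cons (r s a) (fun i => (1 / Real.sqrt d) *
    ∑ s', signVal (W i s') * (if μ s' = 0 then 0 else P s a s' / Real.sqrt (μ s')))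

/-- Weight vector `w_{f,h} = 1 ⊕ (1/√d)·W·(√(μ_h(·))·f_{h+1}(·)) ∈ ℝ^{d+1}`. -/
noncomputable def wFeat {S : Type*} [Fintype S] (d : ℕ)
    (W : Fin d → S → Bool) (μ : S → ℝ) (g : S → ℝ) : Fin (d + 1) → ℝ :=
  Fin.cons 1 (fun i => (1 / Real.sqrt d) *
    ∑ s', signVal (W i s') * (Real.sqrt (μ s') * g s'))

open scoped BigOperators

/-- The Rademacher linear form `⟨x, u⟩ = ∑ s, ±u_s`. -/
noncomputable def signForm {S : Type*} [Fintype S] (x : S → Bool) (u : S → ℝ) : ℝ :=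
  ∑ s, signVal (x s) * u s

/-- The probability of an event under the uniform distribution on a finite type. -/
noncomputable def unifProb {Ω : Type*} [Fintype Ω] (p : Ω → Prop) : ℝ :=
  𝔼 x, if p x then (1 : ℝ) else 0

section UniformProbability

variable {Ω : Type*} [Fintype Ω]

theorem unifProb_mono {p q : Ω → Prop} (h : ∀ x, p x → q x) : unifProb p ≤ unifProb q := by
  refine expect_le_expect fun x _ => ?_
  by_cases hp : p x
  · simp [hp, h x hp]
  · simp only [hp, if_false]
    split_ifs <;> norm_num

theorem unifProb_or_le (p q : Ω → Prop) :
    unifProb (fun x => p x ∨ q x) ≤ unifProb p + unifProb q := by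
  unfold unifProb
  rw [← expect_add_distrib]
  refine expect_le_expect fun x _ => ?_
  by_cases hp : p x <;> by_cases hq : q x <;> simp [hp, hq]

theorem unifProb_exists_le {ι : Type*} (I : Finset ι) (p : ι → Ω → Prop) {b : ℝ}
    (hb : ∀ i ∈ I, unifProb (p i) ≤ b) :
    unifProb (fun x => ∃ i ∈ I, p i x) ≤ #I * b := by
  calc unifProb (fun x => ∃ i ∈ I, p i x) ≤ ∑ i ∈ I, unifProb (p i) := by
        unfold unifProb
        rw [← expect_sum_comm]
        refine expect_le_expect fun x _ => ?_
        have hnn : ∀ i ∈ I, (0 : ℝ) ≤ if p i x then 1 else 0 := fun i _ => by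
          split_ifs <;> norm_num
        split_ifs with h
        · obtain ⟨i, hi, hpi⟩ := h
          refine le_trans ?_ (single_le_sum hnn hi)
          simp [hpi]
        · exact sum_nonneg hnn
    _ ≤ #I * b := by
        rw [← nsmul_eq_mul]
        exact sum_le_card_nsmul _ _ _ hb

theorem unifProb_le_expect_div {f : Ω → ℝ} (hf : ∀ x, 0 ≤ f x) {a : ℝ} (ha : 0 < a) :
    unifProb (fun x => a ≤ f x) ≤ (𝔼 x, f x) / a := by
  rw [expect_div]
  refine expect_le_expect fun x _ => ?_
  split_ifs with h
  · rwa [one_le_div ha]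
  · exact div_nonneg (hf x) ha.le

theorem card_filter_div_eq_one_sub_unifProb [Nonempty Ω] (p : Ω → Prop) [DecidablePred p] :
    ((univ.filter p).card : ℝ) / Fintype.card Ω = 1 - unifProb (fun x => ¬ p x) := by
  have h1 : ((univ.filter p).card : ℝ) / Fintype.card Ω = 𝔼 x, if p x then (1 : ℝ) else 0 := by
    rw [Fintype.expect_eq_sum_div_card]
    simp
  rw [h1, eq_sub_iff_add_eq, unifProb, ← expect_add_distrib, ← Fintype.expect_one (ι := Ω) (M := ℝ)]
  refine expect_congr rfl fun x _ => ?_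
  by_cases hp : p x <;> simp [hp]

end UniformProbability

theorem expect_pi_prod {ι X : Type*} [Fintype ι] [DecidableEq ι] [Fintype X] (g : ι → X → ℝ) :
    𝔼 W : ι → X, ∏ i, g i (W i) = ∏ i, 𝔼 x, g i x := by
  simp_rw [Fintype.expect_eq_sum_div_card]
  rw [Finset.prod_div_distrib, Fintype.prod_sum]
  simp

/-- Chernoff's bound for a sum of independent copies of `g`. -/
theorem unifProb_le_sum_le_exp {X : Type*} [Fintype X] {d : ℕ} {g : X → ℝ}
    {b : ℝ} (hg : 𝔼 x, Real.exp (g x) ≤ Real.exp b) (a : ℝ) :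
    unifProb (fun W : Fin d → X => a ≤ ∑ i, g (W i)) ≤ Real.exp (d * b - a) := by
  calc unifProb (fun W : Fin d → X => a ≤ ∑ i, g (W i))
      ≤ 𝔼 W : Fin d → X, (∏ i, Real.exp (g (W i))) * Real.exp (-a) := by
        refine expect_le_expect fun W _ => ?_
        rw [← Real.exp_sum, ← Real.exp_add]
        split_ifs with h
        · exact Real.one_le_exp (by linarith)
        · positivity
    _ = (𝔼 x, Real.exp (g x)) ^ d * Real.exp (-a) := by
        rw [← expect_mul, expect_pi_prod (fun (_ : Fin d) x => Real.exp (g x))]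
        simp
    _ ≤ Real.exp b ^ d * Real.exp (-a) := by
        have : 0 ≤ 𝔼 x, Real.exp (g x) := expect_nonneg fun _ _ => (Real.exp_pos _).le
        gcongr
    _ = Real.exp (d * b - a) := by
        rw [← Real.exp_nat_mul, ← Real.exp_add]
        ring_nf

section Rademacher

variable {S : Type*} [Fintype S]

theorem signForm_const_mul (x : S → Bool) (c : ℝ) (u : S → ℝ) :
    signForm x (fun s => c * u s) = c * signForm x u := by
  simp only [signForm, mul_sum]
  exact sum_congr rfl fun s _ => by ring

theorem abs_sum_mul_le_one {u v : S → ℝ} (hu : ∑ s, u s ^ 2 ≤ 1) (hv : ∑ s, v s ^ 2 ≤ 1) :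
    |∑ s, u s * v s| ≤ 1 := by
  rw [← sq_le_one_iff_abs_le_one]
  have := sum_mul_sq_le_sq_mul_sq univ u v
  have hv0 : 0 ≤ ∑ s, v s ^ 2 := sum_nonneg fun _ _ => sq_nonneg _
  nlinarith

variable [DecidableEq S]

theorem expect_exp_signForm_le (u : S → ℝ) :
    𝔼 x : S → Bool, Real.exp (signForm x u) ≤ Real.exp ((∑ s, u s ^ 2) / 2) := by
  simp_rw [signForm, Real.exp_sum]
  rw [expect_pi_prod (fun s b => Real.exp (signVal b * u s)), sum_div, Real.exp_sum]
  refine prod_le_prod (fun s _ => expect_nonneg fun _ _ => (Real.exp_pos _).le) fun s _ => ?_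
  refine le_trans (le_of_eq ?_) (Real.cosh_le_exp_half_sq (u s))
  rw [Fintype.expect_eq_sum_div_card, Real.cosh_eq]
  simp [signVal]

theorem expect_signVal_mul (s t : S) :
    𝔼 x : S → Bool, signVal (x s) * signVal (x t) = if s = t then 1 else 0 := by
  split_ifs with h
  · subst h
    rw [← Fintype.expect_one (ι := S → Bool) (M := ℝ)]
    refine expect_congr rfl fun x _ => ?_
    cases x s <;> simp [signVal]
  · have hinv : Function.Involutive (fun x : S → Bool => Function.update x s (!x s)) := by
      intro x
      simp
    have h2 : 𝔼 x : S → Bool, signVal (x s) * signVal (x t)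
        = 𝔼 x : S → Bool, -(signVal (x s) * signVal (x t)) := by
      refine Fintype.expect_equiv hinv.toPerm _ _ fun x => ?_
      have hts : t ≠ s := fun e => h e.symm
      simp only [Function.Involutive.coe_toPerm, Function.update_self, Function.update_of_ne hts]
      cases x s <;> cases x t <;> simp [signVal]
    rw [expect_neg_distrib] at h2
    linarith

theorem expect_signForm_mul (u v : S → ℝ) :
    𝔼 x : S → Bool, signForm x u * signForm x v = ∑ s, u s * v s := by
  simp_rw [signForm, sum_mul_sum]
  rw [expect_sum_comm]
  refine sum_congr rfl fun s _ => ?_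
  rw [expect_sum_comm]
  have : ∀ t, 𝔼 x : S → Bool, signVal (x s) * u s * (signVal (x t) * v t)
      = (if s = t then 1 else 0) * (u s * v t) := fun t => by
    rw [← expect_signVal_mul, expect_mul]
    exact expect_congr rfl fun x _ => by ring
  simp [this]

open MeasureTheory ProbabilityTheory in
theorem integral_exp_mul_gaussianReal (t : ℝ) :
    ∫ g, Real.exp (t * g) ∂(gaussianReal 0 1) = Real.exp (t ^ 2 / 2) := by
  have := congrFun (mgf_id_gaussianReal (μ := 0) (v := 1)) t
  simpa [mgf] using this

open MeasureTheory ProbabilityTheory in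
theorem gaussianPDFReal_mul_exp (g : ℝ) :
    gaussianPDFReal 0 1 g * Real.exp (3 / 8 * g ^ 2)
      = (√(2 * Real.pi))⁻¹ * Real.exp (-(1 / 8) * g ^ 2) := by
  rw [gaussianPDFReal, mul_assoc, ← Real.exp_add]
  simp only [NNReal.coe_one]
  ring_nf

open MeasureTheory ProbabilityTheory in
theorem integral_exp_sq_gaussianReal :
    ∫ g, Real.exp (3 / 8 * g ^ 2) ∂(gaussianReal 0 1) = 2 := by
  rw [integral_gaussianReal_eq_integral_smul one_ne_zero]
  simp_rw [smul_eq_mul, gaussianPDFReal_mul_exp]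
  rw [integral_const_mul, integral_gaussian, show Real.pi / (1 / 8) = 2 ^ 2 * (2 * Real.pi) by ring,
    Real.sqrt_mul (x := 2 ^ 2) (by norm_num), Real.sqrt_sq (by norm_num)]
  have : √(2 * Real.pi) ≠ 0 := by positivity
  field_simp

open MeasureTheory ProbabilityTheory in
theorem integrable_exp_sq_gaussianReal :
    Integrable (fun g : ℝ => Real.exp (3 / 8 * g ^ 2)) (gaussianReal 0 1) := by
  by_contra h
  have := integral_undef h
  rw [integral_exp_sq_gaussianReal] at this
  norm_num at this

open MeasureTheory ProbabilityTheory in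
theorem expect_exp_sq_signForm_le {u : S → ℝ} (hu : ∑ s, u s ^ 2 ≤ 1) :
    𝔼 x : S → Bool, Real.exp (3 / 8 * signForm x u ^ 2) ≤ 2 := by
  have hc : √(3 / 4 : ℝ) ^ 2 = 3 / 4 := Real.sq_sqrt (by norm_num)
  have h1 : ∀ x : S → Bool, Real.exp (3 / 8 * signForm x u ^ 2)
      = ∫ g, Real.exp ((√(3 / 4) * signForm x u) * g) ∂(gaussianReal 0 1) := fun x => by
    rw [integral_exp_mul_gaussianReal, mul_pow, hc]
    ring_nf
  have h2 : 𝔼 x : S → Bool, Real.exp (3 / 8 * signForm x u ^ 2)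
      = ∫ g, (𝔼 x : S → Bool, Real.exp ((√(3 / 4) * signForm x u) * g)) ∂(gaussianReal 0 1) := by
    simp_rw [h1, Fintype.expect_eq_sum_div_card]
    rw [integral_div, integral_finsetSum]
    exact fun x _ => integrable_exp_mul_gaussianReal _
  rw [h2, ← integral_exp_sq_gaussianReal]
  refine integral_mono ?_ integrable_exp_sq_gaussianReal fun g => ?_
  · simp_rw [Fintype.expect_eq_sum_div_card]
    exact (integrable_finsetSum _ fun x _ => integrable_exp_mul_gaussianReal _).div_const _
  · have h3 := expect_exp_signForm_le (fun s => (√(3 / 4) * g) * u s)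
    simp_rw [signForm_const_mul] at h3
    calc 𝔼 x : S → Bool, Real.exp (√(3 / 4) * signForm x u * g)
        = 𝔼 x : S → Bool, Real.exp (√(3 / 4) * g * signForm x u) :=
          expect_congr rfl fun x _ => by ring_nf
      _ ≤ _ := h3
      _ ≤ Real.exp (3 / 8 * g ^ 2) := by
          simp_rw [mul_pow, hc]
          rw [← mul_sum]
          gcongr
          nlinarith [sq_nonneg g]

theorem exp_le_one_add_add_sq_mul_exp_abs (x : ℝ) :
    Real.exp x ≤ 1 + x + x ^ 2 * Real.exp |x| := by
  have h := Complex.norm_exp_sub_sum_le_norm_mul_exp (x : ℂ) 2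
  have h1 : Complex.exp x - ∑ m ∈ range 2, (x : ℂ) ^ m / (m.factorial : ℂ)
      = ((Real.exp x - (1 + x) : ℝ) : ℂ) := by
    simp [sum_range_succ]
  rw [h1, Complex.norm_real, Complex.norm_real, Real.norm_eq_abs, Real.norm_eq_abs, sq_abs] at h
  linarith [le_abs_self (Real.exp x - (1 + x))]

theorem sq_le_mul_exp {z : ℝ} (hz : 0 ≤ z) : z ^ 2 ≤ 5 / 8 * Real.exp z := by
  have h := Real.add_one_le_exp (z / 2 - 1)
  have h1 : Real.exp (z / 2 - 1) * Real.exp 1 = Real.exp (z / 2) := by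
    rw [← Real.exp_add]; ring_nf
  have h2 : (2.6 : ℝ) ≤ Real.exp 1 := by linarith [Real.exp_one_gt_d9]
  have h3 : 1.3 * z ≤ Real.exp (z / 2) := by nlinarith
  have h4 : Real.exp (z / 2) ^ 2 = Real.exp z := by
    rw [← Real.exp_nat_mul]; push_cast; ring_nf
  rw [← h4]
  nlinarith

theorem exp_three_eighths_le : Real.exp (3 / 8) ≤ 3 / 2 := by
  have h1 : Real.exp (3 / 8) ^ 8 = Real.exp 1 ^ 3 := by
    rw [← Real.exp_nat_mul, ← Real.exp_nat_mul]; norm_num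
  have h2 : Real.exp 1 ^ 3 ≤ (3 / 2) ^ 8 := by
    have h3 : Real.exp 1 ≤ 2.75 := by linarith [Real.exp_one_lt_d9]
    calc Real.exp 1 ^ 3 ≤ 2.75 ^ 3 := by gcongr
      _ ≤ _ := by norm_num
  rw [← h1] at h2
  exact le_of_pow_le_pow_left₀ (by norm_num) (by norm_num) h2

/-- Moment generating function of a centred product of two Rademacher forms. -/
theorem expect_exp_signForm_mul_sub_le {u v : S → ℝ} (hu : ∑ s, u s ^ 2 ≤ 1)
    (hv : ∑ s, v s ^ 2 ≤ 1) {l : ℝ} (hl0 : 0 ≤ l) (hl : l ≤ 1 / 8) :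
    𝔼 x : S → Bool, Real.exp (l * (signForm x u * signForm x v - ∑ s, u s * v s))
      ≤ Real.exp (32 * l ^ 2) := by
  set m := ∑ s, u s * v s with hm
  have hm1 : |m| ≤ 1 := abs_sum_mul_le_one hu hv
  have key : ∀ x : S → Bool, Real.exp (l * (signForm x u * signForm x v - m))
      ≤ 1 + l * (signForm x u * signForm x v - m)
        + 8 * l ^ 2 * (Real.exp (3 / 8 * signForm x u ^ 2)
          + Real.exp (3 / 8 * signForm x v ^ 2)) := by
    intro x
    set U := signForm x u
    set V := signForm x v
    set y := |U * V - m| with hy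
    have hy0 : 0 ≤ y := abs_nonneg _
    have hyle : y ≤ (U ^ 2 + V ^ 2) / 2 + 1 := by
      have h1 : y ≤ |U * V| + |m| := abs_sub _ _
      have h2 : |U * V| ≤ (U ^ 2 + V ^ 2) / 2 := by
        rw [abs_le]; constructor <;> nlinarith [sq_nonneg (U + V), sq_nonneg (U - V)]
      linarith
    have h1 := exp_le_one_add_add_sq_mul_exp_abs (l * (U * V - m))
    rw [abs_mul, abs_of_nonneg hl0, mul_pow, ← sq_abs (U * V - m), ← hy] at h1
    have h2 : y ^ 2 ≤ 10 * Real.exp (y / 4) := by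
      have := sq_le_mul_exp (z := y / 4) (by positivity)
      linarith
    have h3 : Real.exp (y / 4) * Real.exp (l * y)
        ≤ 3 / 2 * ((Real.exp (3 / 8 * U ^ 2) + Real.exp (3 / 8 * V ^ 2)) / 2) := by
      have hsq : ∀ z : ℝ, Real.exp (3 / 16 * z) ^ 2 = Real.exp (3 / 8 * z) := fun z => by
        rw [← Real.exp_nat_mul]; push_cast; ring_nf
      calc Real.exp (y / 4) * Real.exp (l * y)
          ≤ Real.exp (3 / 8 + (3 / 16 * U ^ 2 + 3 / 16 * V ^ 2)) := by
            rw [← Real.exp_add]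
            refine Real.exp_le_exp.mpr ?_
            nlinarith
        _ = Real.exp (3 / 8) * (Real.exp (3 / 16 * U ^ 2) * Real.exp (3 / 16 * V ^ 2)) := by
            rw [Real.exp_add, Real.exp_add]
        _ ≤ _ := by
            gcongr
            · exact exp_three_eighths_le
            · rw [← hsq (U ^ 2), ← hsq (V ^ 2)]
              nlinarith [sq_nonneg (Real.exp (3 / 16 * U ^ 2) - Real.exp (3 / 16 * V ^ 2))]
    have h4 : l ^ 2 * y ^ 2 * Real.exp (l * y)
        ≤ l ^ 2 * (10 * Real.exp (y / 4)) * Real.exp (l * y) := by gcongr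
    have h5 := mul_le_mul_of_nonneg_left h3 (sq_nonneg l)
    have h6 : 0 ≤ l ^ 2 * (Real.exp (3 / 8 * U ^ 2) + Real.exp (3 / 8 * V ^ 2)) := by positivity
    linarith
  calc 𝔼 x : S → Bool, Real.exp (l * (signForm x u * signForm x v - m))
      ≤ 𝔼 x : S → Bool, (1 + l * (signForm x u * signForm x v - m)
        + 8 * l ^ 2 * (Real.exp (3 / 8 * signForm x u ^ 2)
          + Real.exp (3 / 8 * signForm x v ^ 2))) := expect_le_expect fun x _ => key x
    _ = 1 + 8 * l ^ 2 * ((𝔼 x : S → Bool, Real.exp (3 / 8 * signForm x u ^ 2))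
          + 𝔼 x : S → Bool, Real.exp (3 / 8 * signForm x v ^ 2)) := by
        rw [expect_add_distrib, expect_add_distrib, ← mul_expect, ← mul_expect,
          expect_sub_distrib, expect_add_distrib, expect_signForm_mul, Fintype.expect_const,
          Fintype.expect_const, ← hm]
        ring
    _ ≤ 1 + 8 * l ^ 2 * (2 + 2) := by
        gcongr
        · exact expect_exp_sq_signForm_le hu
        · exact expect_exp_sq_signForm_le hv
    _ ≤ Real.exp (32 * l ^ 2) := by linarith [Real.add_one_le_exp (32 * l ^ 2)]

theorem unifProb_sum_sq_signForm_le {u : S → ℝ} (hu : ∑ s, u s ^ 2 ≤ 1) (d : ℕ) (t : ℝ) :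
    unifProb (fun W : Fin d → S → Bool => d * t ≤ ∑ i, signForm (W i) u ^ 2)
      ≤ Real.exp (d * (1 - 3 / 8 * t)) := by
  have h := unifProb_le_sum_le_exp (d := d) (b := 1) (g := fun x => 3 / 8 * signForm x u ^ 2)
    ((expect_exp_sq_signForm_le hu).trans (by linarith [Real.add_one_le_exp 1])) (3 / 8 * (d * t))
  refine (unifProb_mono fun W hW => ?_).trans (h.trans_eq ?_)
  · rw [← mul_sum]
    linarith
  · ring_nf

theorem unifProb_le_sum_signForm_mul_sub_le {u v : S → ℝ} (hu : ∑ s, u s ^ 2 ≤ 1)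
    (hv : ∑ s, v s ^ 2 ≤ 1) (d : ℕ) {t : ℝ} (ht0 : 0 ≤ t) (ht1 : t ≤ 1) :
    unifProb (fun W : Fin d → S → Bool =>
        d * t ≤ ∑ i, (signForm (W i) u * signForm (W i) v - ∑ s, u s * v s))
      ≤ Real.exp (-(d * t ^ 2 / 128)) := by
  have h := unifProb_le_sum_le_exp (d := d)
    (expect_exp_signForm_mul_sub_le hu hv (l := t / 64) (by positivity) (by linarith))
    (t / 64 * (d * t))
  refine (unifProb_mono fun W hW => ?_).trans (h.trans_eq ?_)
  · rw [← mul_sum]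
    gcongr
  · ring_nf

theorem unifProb_le_abs_sum_signForm_mul_sub_le {u v : S → ℝ} (hu : ∑ s, u s ^ 2 ≤ 1)
    (hv : ∑ s, v s ^ 2 ≤ 1) (d : ℕ) {t : ℝ} (ht0 : 0 ≤ t) (ht1 : t ≤ 1) :
    unifProb (fun W : Fin d → S → Bool =>
        d * t ≤ |∑ i, (signForm (W i) u * signForm (W i) v - ∑ s, u s * v s)|)
      ≤ 2 * Real.exp (-(d * t ^ 2 / 128)) := by
  have h1 := unifProb_le_sum_signForm_mul_sub_le hu hv d ht0 ht1
  have h2 := unifProb_le_sum_signForm_mul_sub_le (u := fun s => -1 * u s) (by simpa using hu) hv d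
    ht0 ht1
  rw [two_mul]
  refine le_trans ?_ (add_le_add h1 h2)
  refine (unifProb_mono fun W hW => ?_).trans (unifProb_or_le _ _)
  rcases le_abs.mp hW with h | h
  · exact Or.inl h
  · right
    rw [← sum_neg_distrib] at h
    refine h.trans_eq (sum_congr rfl fun i _ => ?_)
    rw [signForm_const_mul]
    simp only [neg_mul, one_mul, sum_neg_distrib]
    ring

end Rademacher

section Scaling

variable {S : Type*} [Fintype S] {v : S → ℝ} {C : ℝ}

theorem sum_sq_inv_sqrt_mul_le_one (hC : 0 < C) (hv : ∑ s, v s ^ 2 ≤ C) :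
    ∑ s, ((√C)⁻¹ * v s) ^ 2 ≤ 1 := by
  simp_rw [mul_pow, inv_pow, Real.sq_sqrt hC.le]
  rw [← mul_sum]
  exact inv_mul_le_one_of_le₀ hv hC.le

variable [DecidableEq S]

theorem unifProb_lt_avg_sq_signForm_le (hC : 0 < C) (hv : ∑ s, v s ^ 2 ≤ C) {d : ℕ} (hd : 0 < d)
    {N : ℝ} (hN : 1 ≤ N) :
    unifProb (fun W : Fin d → S → Bool =>
        C * (16 * Real.log N + 10) < 1 / d * ∑ i, signForm (W i) v ^ 2)
      ≤ Real.exp (-d) / N := by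
  have hd1 : (1 : ℝ) ≤ d := by exact_mod_cast hd
  have hlog : 0 ≤ Real.log N := Real.log_nonneg hN
  have h := unifProb_sum_sq_signForm_le (sum_sq_inv_sqrt_mul_le_one hC hv) d
    (16 * Real.log N + 10)
  refine (unifProb_mono fun W hW => ?_).trans (h.trans ?_)
  · simp_rw [signForm_const_mul, mul_pow, inv_pow, Real.sq_sqrt hC.le]
    rw [← mul_sum, le_inv_mul_iff₀ hC]
    rw [one_div, lt_inv_mul_iff₀ (by positivity)] at hW
    linarith
  · have h1 : Real.exp (-d) / N = Real.exp (-d - Real.log N) := by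
      rw [Real.exp_sub, Real.exp_log (by linarith)]
    rw [h1, Real.exp_le_exp]
    nlinarith

theorem unifProb_le_abs_sum_signForm_mul_sub_le_of_sum_sq_le {u : S → ℝ} (hu : ∑ s, u s ^ 2 ≤ 1)
    (hC : 0 < C) (hv : ∑ s, v s ^ 2 ≤ C) (d : ℕ) {t : ℝ} (ht0 : 0 ≤ t) (htC : t ^ 2 ≤ C) :
    unifProb (fun W : Fin d → S → Bool =>
        d * t ≤ |∑ i, (signForm (W i) u * signForm (W i) v - ∑ s, u s * v s)|)
      ≤ 2 * Real.exp (-(d * t ^ 2 / (128 * C))) := by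
  have hsC : 0 < √C := Real.sqrt_pos.mpr hC
  have ht1 : (√C)⁻¹ * t ≤ 1 := inv_mul_le_one_of_le₀ (Real.le_sqrt_of_sq_le htC) hsC.le
  have h := unifProb_le_abs_sum_signForm_mul_sub_le hu (sum_sq_inv_sqrt_mul_le_one hC hv) d
    (t := (√C)⁻¹ * t) (by positivity) ht1
  refine (unifProb_mono fun W hW => ?_).trans (h.trans_eq ?_)
  · have h1 : ∑ i, (signForm (W i) u * signForm (W i) (fun s => (√C)⁻¹ * v s)
        - ∑ s, u s * ((√C)⁻¹ * v s))
        = (√C)⁻¹ * ∑ i, (signForm (W i) u * signForm (W i) v - ∑ s, u s * v s) := by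
      rw [mul_sum]
      refine sum_congr rfl fun i _ => ?_
      rw [signForm_const_mul, mul_sub, mul_sum]
      congr 1
      · ring
      · exact sum_congr rfl fun s _ => by ring
    rw [h1, abs_mul, abs_of_pos (inv_pos.mpr hsC)]
    calc d * ((√C)⁻¹ * t) = (√C)⁻¹ * (d * t) := by ring
      _ ≤ _ := by gcongr
  · rw [mul_pow, inv_pow, Real.sq_sqrt hC.le]
    congr 3
    field_simp

end Scaling

theorem clip_sub_sq_le {x y ε : ℝ} (hy : y ∈ Set.Icc (0 : ℝ) 2) (hε : 0 < ε) :
    (clip x - y) ^ 2 ≤ ε / 2 + 4 * if √(ε / 2) ≤ |x - y| then 1 else 0 := by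
  obtain ⟨hy0, hy2⟩ := hy
  have h1 : |clip x - y| ≤ |x - y| := by
    have h := abs_max_sub_max_le_abs (min x 2) (min y 2) 0
    rw [min_eq_left hy2, max_eq_left hy0] at h
    refine h.trans ?_
    have h' := abs_min_sub_min_le_max x 2 y 2
    rw [min_eq_left hy2] at h'
    simpa using h'
  have h2 : |clip x - y| ≤ 2 := by
    have h0 : 0 ≤ clip x := le_max_right _ _
    have h3 : clip x ≤ 2 := max_le (min_le_right _ _) (by norm_num)
    rw [abs_le]; constructor <;> linarith
  rw [← sq_abs]
  have h0 := abs_nonneg (clip x - y)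
  split_ifs with h
  · nlinarith
  · push Not at h
    have h3 : |clip x - y| ^ 2 ≤ √(ε / 2) ^ 2 := by
      gcongr
      linarith
    rw [Real.sq_sqrt (by positivity)] at h3
    linarith

section Features

variable {S A : Type*} [Fintype S]

/-- The vector `P(·|s,a)/√μ(·)`, with coordinate `0` where `μ` vanishes. -/
noncomputable def kernelVec (P : S → A → S → ℝ) (μ : S → ℝ) (s : S) (a : A) : S → ℝ :=
  fun s' => if μ s' = 0 then 0 else P s a s' / √(μ s')

/-- The vector `√μ(·)·g(·)`. -/
noncomputable def valueVec (μ g : S → ℝ) : S → ℝ :=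
  fun s' => √(μ s') * g s'

theorem one_div_sqrt_mul_self (d : ℕ) : 1 / √(d : ℝ) * (1 / √(d : ℝ)) = 1 / d := by
  rw [div_mul_div_comm, one_mul, Real.mul_self_sqrt (Nat.cast_nonneg d)]

theorem sum_psiFeat_sq (d : ℕ) (W : Fin d → S → Bool) (P : S → A → S → ℝ) (r : S → A → ℝ)
    (μ : S → ℝ) (s : S) (a : A) :
    ∑ i, psiFeat d W P r μ s a i ^ 2
      = r s a ^ 2 + 1 / d * ∑ i, signForm (W i) (kernelVec P μ s a) ^ 2 := by
  rw [Fin.sum_univ_succ, mul_sum]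
  simp only [psiFeat, Fin.cons_zero, Fin.cons_succ]
  congr 1
  refine sum_congr rfl fun i _ => ?_
  rw [mul_pow, pow_two (1 / √(d : ℝ)), one_div_sqrt_mul_self]
  rfl

theorem sum_wFeat_sq (d : ℕ) (W : Fin d → S → Bool) (μ g : S → ℝ) :
    ∑ i, wFeat d W μ g i ^ 2 = 1 + 1 / d * ∑ i, signForm (W i) (valueVec μ g) ^ 2 := by
  rw [Fin.sum_univ_succ, mul_sum]
  simp only [wFeat, Fin.cons_zero, Fin.cons_succ, one_pow]
  congr 1
  refine sum_congr rfl fun i _ => ?_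
  rw [mul_pow, pow_two (1 / √(d : ℝ)), one_div_sqrt_mul_self]
  rfl

theorem sum_wFeat_mul_psiFeat (d : ℕ) (W : Fin d → S → Bool) (P : S → A → S → ℝ)
    (r : S → A → ℝ) (μ g : S → ℝ) (s : S) (a : A) :
    ∑ i, wFeat d W μ g i * psiFeat d W P r μ s a i
      = r s a + 1 / d * ∑ i, signForm (W i) (valueVec μ g) *
          signForm (W i) (kernelVec P μ s a) := by
  rw [Fin.sum_univ_succ, mul_sum]
  simp only [wFeat, psiFeat, Fin.cons_zero, Fin.cons_succ, one_mul]
  congr 1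
  refine sum_congr rfl fun i _ => ?_
  rw [← one_div_sqrt_mul_self, mul_mul_mul_comm]
  rfl

theorem sum_valueVec_sq_le_one {μ g : S → ℝ} (hμnn : ∀ s, 0 ≤ μ s) (hμsum : ∑ s, μ s = 1)
    (hg : ∀ s, g s ∈ Set.Icc (0 : ℝ) 1) : ∑ s, valueVec μ g s ^ 2 ≤ 1 := by
  rw [← hμsum]
  refine sum_le_sum fun s _ => ?_
  rw [valueVec, mul_pow, Real.sq_sqrt (hμnn s)]
  exact mul_le_of_le_one_right (hμnn s) (pow_le_one₀ (hg s).1 (hg s).2)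

variable {P : S → A → S → ℝ} {μ : S → ℝ} {C : ℝ}

theorem sum_kernelVec_sq_le (hPnn : ∀ s a s', 0 ≤ P s a s') (hPsum : ∀ s a, ∑ s', P s a s' = 1)
    (hC : 0 < C) (hμnn : ∀ s, 0 ≤ μ s) (hcov : ∀ s a s', P s a s' ≤ C * μ s') (s : S) (a : A) :
    ∑ s', kernelVec P μ s a s' ^ 2 ≤ C := by
  calc ∑ s', kernelVec P μ s a s' ^ 2 ≤ ∑ s', C * P s a s' := by
        refine sum_le_sum fun s' _ => ?_
        unfold kernelVec
        split_ifs with h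
        · have := mul_nonneg hC.le (hPnn s a s')
          simpa using this
        · have hpos : 0 < μ s' := lt_of_le_of_ne (hμnn s') (Ne.symm h)
          rw [div_pow, Real.sq_sqrt (hμnn s'), div_le_iff₀ hpos]
          nlinarith [hcov s a s', hPnn s a s']
    _ = C := by rw [← mul_sum, hPsum, mul_one]

theorem sum_valueVec_mul_kernelVec (hPnn : ∀ s a s', 0 ≤ P s a s') (hμnn : ∀ s, 0 ≤ μ s)
    (hcov : ∀ s a s', P s a s' ≤ C * μ s') (g : S → ℝ) (s : S) (a : A) :
    ∑ s', valueVec μ g s' * kernelVec P μ s a s' = ∑ s', P s a s' * g s' := by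
  refine sum_congr rfl fun s' _ => ?_
  unfold valueVec kernelVec
  split_ifs with h
  · have h1 := hcov s a s'
    rw [h, mul_zero] at h1
    simp [le_antisymm h1 (hPnn s a s')]
  · have : √(μ s') ≠ 0 :=
      (Real.sqrt_pos.mpr (lt_of_le_of_ne (hμnn s') (Ne.symm h))).ne'
    field_simp

theorem one_le_of_pushforward_coverage [Nonempty S] [Nonempty A]
    (hPsum : ∀ s a, ∑ s', P s a s' = 1) (hμsum : ∑ s, μ s = 1)
    (hcov : ∀ s a s', P s a s' ≤ C * μ s') : 1 ≤ C := by
  obtain ⟨s⟩ := ‹Nonempty S›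
  obtain ⟨a⟩ := ‹Nonempty A›
  calc 1 = ∑ s', P s a s' := (hPsum s a).symm
    _ ≤ ∑ s', C * μ s' := sum_le_sum fun s' _ => hcov s a s'
    _ = C := by rw [← mul_sum, hμsum, mul_one]

variable [DecidableEq S] [Fintype A] [Nonempty A]

/-- Tail bound for the average squared error of the clipped embedded Bellman backup. -/
theorem unifProb_lt_sum_clip_sub_sq_le (hPnn : ∀ s a s', 0 ≤ P s a s')
    (hPsum : ∀ s a, ∑ s', P s a s' = 1) {r : S → A → ℝ} (hr : ∀ s a, r s a ∈ Set.Icc (0 : ℝ) 1)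
    (hC : 1 ≤ C) (hμnn : ∀ s, 0 ≤ μ s) (hμsum : ∑ s, μ s = 1)
    (hcov : ∀ s a s', P s a s' ≤ C * μ s') {g : S → ℝ} (hg : ∀ s, g s ∈ Set.Icc (0 : ℝ) 1)
    {ε : ℝ} (hε : ε ∈ Set.Ioo (0 : ℝ) 1) {d : ℕ} (hd : 0 < d) :
    unifProb (fun W : Fin d → S → Bool =>
        ε < ∑ s, ∑ a, μ s * (1 / (Fintype.card A : ℝ)) *
          (clip (∑ i, wFeat d W μ g i * psiFeat d W P r μ s a i)
            - (r s a + ∑ s', P s a s' * g s')) ^ 2)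
      ≤ 16 / ε * Real.exp (-(d * ε / (256 * C))) := by
  obtain ⟨hε0, hε1⟩ := hε
  have hd0 : (0 : ℝ) < d := by exact_mod_cast hd
  have hC0 : 0 < C := by linarith
  set t := √(ε / 2)
  have ht2 : t ^ 2 = ε / 2 := Real.sq_sqrt (by positivity)
  let X : (Fin d → S → Bool) → S → A → ℝ := fun W s a =>
    ∑ i, wFeat d W μ g i * psiFeat d W P r μ s a i
  let y : S → A → ℝ := fun s a => r s a + ∑ s', P s a s' * g s'
  let q : S → ℝ := fun s => μ s * (1 / (Fintype.card A : ℝ))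
  have hq0 : ∀ s, 0 ≤ q s := fun s => mul_nonneg (hμnn s) (by positivity)
  have hqsum : ∑ s, ∑ _a : A, q s = 1 := by
    rw [← hμsum]
    refine sum_congr rfl fun s _ => ?_
    have : (Fintype.card A : ℝ) ≠ 0 := by simp
    simp only [q, sum_const, card_univ, nsmul_eq_mul]
    field_simp
  have hy : ∀ s a, y s a ∈ Set.Icc (0 : ℝ) 2 := fun s a => by
    have h0 : 0 ≤ ∑ s', P s a s' * g s' :=
      sum_nonneg fun s' _ => mul_nonneg (hPnn s a s') (hg s').1
    have h1 : ∑ s', P s a s' * g s' ≤ 1 := by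
      rw [← hPsum s a]
      exact sum_le_sum fun s' _ => mul_le_of_le_one_right (hPnn s a s') (hg s').2
    exact ⟨by linarith [(hr s a).1], by linarith [(hr s a).2]⟩
  have hpt : ∀ s a, unifProb (fun W => t ≤ |X W s a - y s a|)
      ≤ 2 * Real.exp (-(d * ε / (256 * C))) := fun s a => by
    have h := unifProb_le_abs_sum_signForm_mul_sub_le_of_sum_sq_le
      (sum_valueVec_sq_le_one hμnn hμsum hg) hC0
      (sum_kernelVec_sq_le hPnn hPsum hC0 hμnn hcov s a) d (t := t) (Real.sqrt_nonneg _)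
      (by rw [ht2]; linarith)
    refine (unifProb_mono fun W hW => ?_).trans (h.trans_eq ?_)
    · have h1 : X W s a - y s a = 1 / d * ∑ i, (signForm (W i) (valueVec μ g) *
          signForm (W i) (kernelVec P μ s a) - ∑ s', valueVec μ g s' * kernelVec P μ s a s') := by
        simp only [X, y]
        rw [sum_wFeat_mul_psiFeat, sum_valueVec_mul_kernelVec hPnn hμnn hcov, sum_sub_distrib]
        simp only [sum_const, card_univ, Fintype.card_fin, nsmul_eq_mul]
        field_simp
        ring
      rw [h1, abs_mul, abs_of_pos (by positivity), one_div, le_inv_mul_iff₀ hd0] at hW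
      exact hW
    · rw [ht2]
      congr 3
      field_simp
      norm_num
  let B : (Fin d → S → Bool) → ℝ := fun W =>
    ∑ s, ∑ a, q s * if t ≤ |X W s a - y s a| then 1 else 0
  have hB0 : ∀ W, 0 ≤ B W := fun W => sum_nonneg fun s _ => sum_nonneg fun a _ =>
    mul_nonneg (hq0 s) (by split_ifs <;> norm_num)
  have hEB : 𝔼 W, B W ≤ 2 * Real.exp (-(d * ε / (256 * C))) := by
    calc 𝔼 W, B W = ∑ s, ∑ a, q s * unifProb (fun W => t ≤ |X W s a - y s a|) := by
          simp only [B, unifProb]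
          rw [expect_sum_comm]
          refine sum_congr rfl fun s _ => ?_
          rw [expect_sum_comm]
          exact sum_congr rfl fun a _ => (mul_expect _ _ _).symm
      _ ≤ ∑ s, ∑ _a : A, q s * (2 * Real.exp (-(d * ε / (256 * C)))) :=
          sum_le_sum fun s _ => sum_le_sum fun a _ =>
            mul_le_mul_of_nonneg_left (hpt s a) (hq0 s)
      _ = 2 * Real.exp (-(d * ε / (256 * C))) := by
          simp_rw [← sum_mul]
          rw [hqsum, one_mul]
  calc unifProb (fun W => ε < ∑ s, ∑ a, q s * (clip (X W s a) - y s a) ^ 2)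
      ≤ unifProb (fun W => ε / 8 ≤ B W) := by
        refine unifProb_mono fun W hW => ?_
        have h1 : ∑ s, ∑ a, q s * (clip (X W s a) - y s a) ^ 2 ≤ ε / 2 + 4 * B W := by
          calc ∑ s, ∑ a, q s * (clip (X W s a) - y s a) ^ 2
              ≤ ∑ s, ∑ a, (q s * (ε / 2)
                + 4 * (q s * if t ≤ |X W s a - y s a| then 1 else 0)) := by
                refine sum_le_sum fun s _ => sum_le_sum fun a _ => ?_
                have := mul_le_mul_of_nonneg_left (clip_sub_sq_le (x := X W s a) (hy s a) hε0)
                  (hq0 s)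
                linarith
            _ = ε / 2 + 4 * B W := by
                have hconst : ∑ s, ∑ _a : A, q s * (ε / 2) = ε / 2 := by
                  simp_rw [← sum_mul]
                  rw [hqsum, one_mul]
                simp_rw [sum_add_distrib]
                rw [hconst]
                simp only [B, mul_sum]
        linarith
    _ ≤ (𝔼 W, B W) / (ε / 8) := unifProb_le_expect_div hB0 (by positivity)
    _ ≤ 2 * Real.exp (-(d * ε / (256 * C))) / (ε / 8) := by gcongr
    _ = 16 / ε * Real.exp (-(d * ε / (256 * C))) := by
        field_simp
        norm_num

end Features

/-- (Low-dimensional embeddings for pushforward-coverable MDPs.)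
Let `M` be a finite MDP with kernels `P_h`, mean rewards `r_h ∈ [0,1]`, and pushforward
coverability witness `μ_h` (`P_h(s'|s,a) ≤ C_push·μ_h(s')`).  Let `F` be a finite class
of tuples `f = (f_1,…,f_{H+1})`, `f_h : S → [0,1]`, and draw `W ∈ {±1}^{d×S}` with
independent Rademacher entries.  If `d ≥ 2⁹·C_push·log(16|F|H/(δε))/ε`, then with
probability at least `1 − δ` over `W`:
(i) for all `f ∈ F`, `h ∈ [H]`:
`Σ_{s,a} μ_h(s)·(1/|A|)·(clip⟨w_{f,h}, ψ_h(s,a)⟩ − [T_h f_{h+1}](s,a))² ≤ ε`;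
(ii) `max_{s,a,h} ‖ψ_h(s,a)‖₂² ≤ C_push·(16 log(|S||A|H) + 11)`;
(iii) `max_{f,h} ‖w_{f,h}‖₂² ≤ 16 log(|F|H) + 11`,
where `[T_h g](s,a) = r_h(s,a) + Σ_{s'} P_h(s'|s,a)·g(s')`. -/
theorem statement2 (S A : Type*) [Fintype S] [Fintype A] [Nonempty S] [Nonempty A]
    (H : ℕ) (hH : 0 < H) (d : ℕ) (hd : 0 < d)
    (P : Fin H → S → A → S → ℝ)
    (hPnn : ∀ h s a s', 0 ≤ P h s a s')
    (hPsum : ∀ h s a, ∑ s', P h s a s' = 1)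
    (r : Fin H → S → A → ℝ) (hr : ∀ h s a, r h s a ∈ Set.Icc (0:ℝ) 1)
    (Cpush : ℝ) (hC : 0 < Cpush)
    (μ : Fin H → S → ℝ) (hμnn : ∀ h s, 0 ≤ μ h s) (hμsum : ∀ h, ∑ s, μ h s = 1)
    (hcov : ∀ h s a s', P h s a s' ≤ Cpush * μ h s')
    (F : Finset (Fin (H + 1) → S → ℝ)) (hFne : F.Nonempty)
    (hFbd : ∀ f ∈ F, ∀ h s, f h s ∈ Set.Icc (0:ℝ) 1)
    (ε δ : ℝ) (hε : ε ∈ Set.Ioo (0:ℝ) 1) (hδ : δ ∈ Set.Ioo (0:ℝ) 1)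
    (hdim : (2:ℝ)^9 * Cpush * Real.log (16 * (F.card : ℝ) * H / (δ * ε)) / ε ≤ (d:ℝ)) :
    (1 : ℝ) - δ ≤
      ((Finset.univ.filter (fun W : Fin d → S → Bool =>
          (∀ f ∈ F, ∀ h : Fin H,
            ∑ s, ∑ a, μ h s * (1 / (Fintype.card A : ℝ)) *
              (clip (∑ i : Fin (d + 1),
                  wFeat d W (μ h) (f h.succ) i * psiFeat d W (P h) (r h) (μ h) s a i)
                - (r h s a + ∑ s', P h s a s' * f h.succ s')) ^ 2 ≤ ε)
          ∧ (∀ h : Fin H, ∀ s a,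
              ∑ i : Fin (d + 1), (psiFeat d W (P h) (r h) (μ h) s a i) ^ 2
                ≤ Cpush * (16 * Real.log ((Fintype.card S : ℝ) * (Fintype.card A) * H) + 11))
          ∧ (∀ f ∈ F, ∀ h : Fin H,
              ∑ i : Fin (d + 1), (wFeat d W (μ h) (f h.succ) i) ^ 2
                ≤ 16 * Real.log ((F.card : ℝ) * H) + 11))).card : ℝ)
        / (Fintype.card (Fin d → S → Bool) : ℝ) := by
  obtain ⟨hε0, hε1⟩ := hε
  obtain ⟨hδ0, hδ1⟩ := hδ
  have hC1 : 1 ≤ Cpush :=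
    one_le_of_pushforward_coverage (hPsum ⟨0, hH⟩) (hμsum ⟨0, hH⟩) (hcov ⟨0, hH⟩)
  have hF1 : (1 : ℝ) ≤ F.card := by exact_mod_cast hFne.card_pos
  have hH1 : (1 : ℝ) ≤ H := by exact_mod_cast hH
  have hS1 : (1 : ℝ) ≤ Fintype.card S := by exact_mod_cast Fintype.card_pos
  have hA1 : (1 : ℝ) ≤ Fintype.card A := by exact_mod_cast Fintype.card_pos
  have hFH1 : 1 ≤ (F.card : ℝ) * H := one_le_mul_of_one_le_of_one_le hF1 hH1
  have hSA1 : 1 ≤ (Fintype.card S : ℝ) * Fintype.card A := one_le_mul_of_one_le_of_one_le hS1 hA1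
  have hSAH1 : 1 ≤ (Fintype.card S : ℝ) * Fintype.card A * H :=
    one_le_mul_of_one_le_of_one_le hSA1 hH1
  set K := 16 * (F.card : ℝ) * H / (δ * ε) with hK
  have hK16 : 16 / δ ≤ K := by
    rw [hK, div_le_div_iff₀ hδ0 (by positivity)]
    have h1 : δ * ε ≤ δ := mul_le_of_le_one_right hδ0.le hε1.le
    nlinarith
  have hK0 : 0 < K := lt_of_lt_of_le (by positivity) hK16
  have hinvK : K⁻¹ ≤ δ / 16 := by
    rw [← inv_div]
    exact inv_anti₀ (by positivity) hK16
  have hlogK : 0 ≤ Real.log K := by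
    refine Real.log_nonneg (le_trans ?_ hK16)
    rw [one_le_div hδ0]
    linarith
  have hdim' : 2 * Real.log K ≤ d * ε / (256 * Cpush) := by
    rw [div_le_iff₀ hε0] at hdim
    rw [le_div_iff₀ (by positivity)]
    linarith
  have hexp_d : Real.exp (-d) ≤ δ / 16 := by
    refine le_trans ?_ hinvK
    rw [← Real.exp_log (inv_pos.mpr hK0), Real.log_inv, Real.exp_le_exp, neg_le_neg_iff]
    have h1 : d * ε / (256 * Cpush) ≤ d := by
      rw [div_le_iff₀ (by positivity)]
      have hd0 : (0 : ℝ) ≤ d := Nat.cast_nonneg d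
      nlinarith [mul_le_mul_of_nonneg_left hε1.le hd0, mul_le_mul_of_nonneg_left hC1 hd0]
    linarith
  have hexp_K : Real.exp (-(d * ε / (256 * Cpush))) ≤ K⁻¹ ^ 2 := by
    rw [← Real.exp_log (inv_pos.mpr hK0), ← Real.exp_nat_mul, Real.exp_le_exp, Real.log_inv]
    push_cast
    linarith
  have herr := unifProb_exists_le (F ×ˢ (univ : Finset (Fin H)))
    (fun p (W : Fin d → S → Bool) => ε < ∑ s, ∑ a, μ p.2 s * (1 / (Fintype.card A : ℝ)) *
      (clip (∑ i, wFeat d W (μ p.2) (p.1 p.2.succ) i * psiFeat d W (P p.2) (r p.2) (μ p.2) s a i)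
        - (r p.2 s a + ∑ s', P p.2 s a s' * p.1 p.2.succ s')) ^ 2)
    (fun p hp => unifProb_lt_sum_clip_sub_sq_le (hPnn p.2) (hPsum p.2) (hr p.2) hC1 (hμnn p.2)
      (hμsum p.2) (hcov p.2) (hFbd p.1 (mem_product.mp hp).1 p.2.succ) ⟨hε0, hε1⟩ hd)
  have hpsi := unifProb_exists_le (univ : Finset (S × A × Fin H))
    (fun p (W : Fin d → S → Bool) =>
      Cpush * (16 * Real.log ((Fintype.card S : ℝ) * (Fintype.card A) * H) + 10)
        < 1 / d * ∑ i, signForm (W i) (kernelVec (P p.2.2) (μ p.2.2) p.1 p.2.1) ^ 2)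
    (fun p _ => unifProb_lt_avg_sq_signForm_le hC
      (sum_kernelVec_sq_le (hPnn _) (hPsum _) hC (hμnn _) (hcov _) _ _) hd hSAH1)
  have hw := unifProb_exists_le (F ×ˢ (univ : Finset (Fin H)))
    (fun p (W : Fin d → S → Bool) => 1 * (16 * Real.log ((F.card : ℝ) * H) + 10)
        < 1 / d * ∑ i, signForm (W i) (valueVec (μ p.2) (p.1 p.2.succ)) ^ 2)
    (fun p hp => unifProb_lt_avg_sq_signForm_le one_pos
      (sum_valueVec_sq_le_one (hμnn _) (hμsum _) (hFbd p.1 (mem_product.mp hp).1 p.2.succ)) hd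
      hFH1)
  rw [card_filter_div_eq_one_sub_unifProb]
  refine sub_le_sub_left ?_ 1
  refine le_trans ((unifProb_mono fun W hW => ?_).trans ((unifProb_or_le _ _).trans
    (add_le_add herr ((unifProb_or_le _ _).trans (add_le_add hpsi hw))))) ?_
  · by_contra hcon
    push Not at hcon
    obtain ⟨h1, h2, h3⟩ := hcon
    refine hW ⟨fun f hf h => h1 (f, h) (by simp [hf]), fun h s a => ?_, fun f hf h => ?_⟩
    · have h4 := h2 (s, a, h) (mem_univ _)
      have h5 : r h s a ^ 2 ≤ 1 := pow_le_one₀ (hr h s a).1 (hr h s a).2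
      rw [sum_psiFeat_sq]
      linarith
    · have h4 := h3 (f, h) (by simp [hf])
      rw [sum_wFeat_sq]
      linarith
  · have e1 : (#(F ×ˢ (univ : Finset (Fin H))) : ℝ) = F.card * H := by simp [card_product]
    have e2 : (#(univ : Finset (S × A × Fin H)) : ℝ)
        = (Fintype.card S : ℝ) * Fintype.card A * H := by
      simp [mul_assoc]
    rw [e1, e2, mul_div_cancel₀ _ (by positivity), mul_div_cancel₀ _ (by positivity)]
    have h1 : (F.card : ℝ) * H * (16 / ε * Real.exp (-(d * ε / (256 * Cpush)))) ≤ δ * K⁻¹ := by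
      calc (F.card : ℝ) * H * (16 / ε * Real.exp (-(d * ε / (256 * Cpush))))
          ≤ (F.card : ℝ) * H * (16 / ε * K⁻¹ ^ 2) := by gcongr
        _ = δ * K * K⁻¹ ^ 2 := by
            rw [hK]
            field_simp
        _ = δ * K⁻¹ := by field_simp
    have h2 : δ * K⁻¹ ≤ 1 * (δ / 16) := by gcongr
    linarith
end

section
/- Let Z and A be finite nonempty sets and P : Z × A → Δ(Z) a probability kernel. Then inf_{μ∈Δ(Z)} sup_{(z,a,z') ∈ Z×A×Z} P(z'|z,a)/μ(z') = Σ_{z'∈Z} max_{(z,a)∈Z×A} P(z'|z,a), where the ratio uses the conventions c/0 = +∞ for c > 0 and 0/0 = 0. -/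
open Finset ENNReal

/-- For finite nonempty sets `Z, A` and a probability kernel
`P : Z × A → Δ(Z)`,
`inf_{μ ∈ Δ(Z)} sup_{(z,a,z')} P(z'|z,a)/μ(z') = Σ_{z'} max_{(z,a)} P(z'|z,a)`.
Ratios are taken in `ℝ≥0∞`, where the conventions `c/0 = ∞` for `c > 0` and `0/0 = 0`
hold, and `Δ(Z)` is the set of (extended-real-valued) probability mass functions on `Z`. -/
theorem statement3 (Z A : Type*) [Fintype Z] [Fintype A] [Nonempty Z] [Nonempty A]
    (P : Z → A → Z → ℝ)
    (hP0 : ∀ z a z', 0 ≤ P z a z')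
    (hP1 : ∀ z a, ∑ z', P z a z' = 1) :
    (⨅ μ : {μ : Z → ℝ≥0∞ // ∑ z, μ z = 1},
        ⨆ z : Z, ⨆ a : A, ⨆ z' : Z, ENNReal.ofReal (P z a z') / μ.1 z')
      = ∑ z' : Z, ⨆ z : Z, ⨆ a : A, ENNReal.ofReal (P z a z') := by
  set M : Z → ℝ≥0∞ := fun z' => ⨆ z : Z, ⨆ a : A, ENNReal.ofReal (P z a z')
  have hle (z : Z) (a : A) (z' : Z) : ENNReal.ofReal (P z a z') ≤ M z' :=
    le_iSup₂_of_le z a le_rfl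
  have hM_le (z' : Z) : M z' ≤ 1 := by
    refine iSup₂_le fun z a => ENNReal.ofReal_le_one.2 ?_
    rw [← hP1 z a]
    exact Finset.single_le_sum (fun i _ => hP0 z a i) (Finset.mem_univ z')
  have hS_top : ∑ z', M z' ≠ ∞ :=
    ENNReal.sum_ne_top.2 fun z' _ => ne_top_of_le_ne_top ENNReal.one_ne_top (hM_le z')
  have hS_zero : ∑ z', M z' ≠ 0 := by
    obtain ⟨z⟩ := ‹Nonempty Z›
    obtain ⟨a⟩ := ‹Nonempty A›
    have h : (1 : ℝ≥0∞) ≤ ∑ z', M z' := by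
      rw [← ENNReal.ofReal_one, ← hP1 z a,
        ENNReal.ofReal_sum_of_nonneg fun i _ => hP0 z a i]
      exact Finset.sum_le_sum fun z' _ => hle z a z'
    exact (zero_lt_one.trans_le h).ne'
  apply le_antisymm
  · refine iInf_le_of_le ⟨fun z' => M z' / ∑ i, M i, ?_⟩ ?_
    · simp only [div_eq_mul_inv]
      rw [← Finset.sum_mul, ENNReal.mul_inv_cancel hS_zero hS_top]
    · refine iSup₂_le fun z a => iSup_le fun z' => ENNReal.div_le_of_le_mul ?_
      rw [ENNReal.mul_div_cancel hS_zero hS_top]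
      exact hle z a z'
  · refine le_iInf fun μ => ?_
    set L := ⨆ z : Z, ⨆ a : A, ⨆ z' : Z, ENNReal.ofReal (P z a z') / μ.1 z'
    by_cases hL_top : L = ∞
    · rw [hL_top]
      exact le_top
    have hμ_top (z' : Z) : μ.1 z' ≠ ∞ :=
      ENNReal.sum_ne_top.1 (μ.2.trans_ne ENNReal.one_ne_top) z' (Finset.mem_univ z')
    calc ∑ z', M z' ≤ ∑ z', L * μ.1 z' := by
          refine Finset.sum_le_sum fun z' _ => iSup₂_le fun z a => ?_
          rw [← ENNReal.div_le_iff_le_mul (Or.inr hL_top) (Or.inl (hμ_top z'))]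
          exact le_iSup₂_of_le z a (le_iSup (fun i => ENNReal.ofReal (P z a i) / μ.1 i) z')
      _ = L := by rw [← Finset.mul_sum, μ.2, mul_one]
end

section
/- Let M be a finite MDP over finite state space Z and finite action space A with horizon H, and let Π be a nonempty set of policies. Then for every h ∈ [H], inf_{μ∈Δ(Z)} sup_{π∈Π} sup_{z∈Z} d^{M,π}_h(z)/μ(z) = Σ_{z∈Z} sup_{π∈Π} d^{M,π}_h(z), where the ratio uses the conventions c/0 = +∞ for c > 0 and 0/0 = 0. -/
open Finset ENNReal

/-- Occupancy measure of a finite-horizon MDP (layers are 0-indexed: layer `0`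
carries the initial distribution `P0`, `P h` is the transition kernel from layer `h`
to layer `h+1`, and `pol h` is the policy at layer `h`):
`d_0 = P0`, `d_{h+1}(z') = Σ_{z,a} d_h(z)·pol_h(a|z)·P_h(z'|z,a)`. -/
noncomputable def docc {Z A : Type*} [Fintype Z] [Fintype A]
    (P0 : Z → ℝ) (P : ℕ → Z → A → Z → ℝ) (pol : ℕ → Z → A → ℝ) : ℕ → Z → ℝ
  | 0 => P0
  | h + 1 => fun z' => ∑ z, ∑ a, docc P0 P pol h z * pol h z a * P h z a z'

/-- The occupancy measure of every layer is a probability vector, provided the kernels and policy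
of the earlier layers are stochastic. -/
lemma docc_nonneg_and_sum_eq_one {Z A : Type*} [Fintype Z] [Fintype A]
    {P0 : Z → ℝ} (hP00 : ∀ z, 0 ≤ P0 z) (hP01 : ∑ z, P0 z = 1)
    {P : ℕ → Z → A → Z → ℝ} {pol : ℕ → Z → A → ℝ} (h : ℕ)
    (hPnn : ∀ k < h, ∀ z a z', 0 ≤ P k z a z')
    (hPsum : ∀ k < h, ∀ z a, ∑ z', P k z a z' = 1)
    (hpol : ∀ k < h, ∀ z, (∀ a, 0 ≤ pol k z a) ∧ ∑ a, pol k z a = 1) :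
    (∀ z, 0 ≤ docc P0 P pol h z) ∧ ∑ z, docc P0 P pol h z = 1 := by
  induction h with
  | zero => exact ⟨hP00, hP01⟩
  | succ k ih =>
    obtain ⟨hnn, hsum⟩ := ih (fun j hj => hPnn j (by omega)) (fun j hj => hPsum j (by omega))
      (fun j hj => hpol j (by omega))
    have hk : k < k + 1 := by omega
    refine ⟨fun z' => Finset.sum_nonneg fun z _ => Finset.sum_nonneg fun a _ =>
      mul_nonneg (mul_nonneg (hnn z) ((hpol k hk z).1 a)) (hPnn k hk z a z'), ?_⟩
    calc ∑ z', docc P0 P pol (k + 1) z'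
        = ∑ z, ∑ a, ∑ z', docc P0 P pol k z * pol k z a * P k z a z' := by
          simp only [docc]
          rw [Finset.sum_comm]
          exact Finset.sum_congr rfl fun z _ => Finset.sum_comm
      _ = 1 := by
          simp only [← Finset.mul_sum, hPsum k hk, (hpol k hk _).2, mul_one, hsum]

/-- The best worst-case density ratio of a family of finite `ℝ≥0∞`-valued weights against a
probability vector is the total mass of the pointwise supremum of the family. -/
lemma iInf_iSup_div_eq_sum_iSup {ι Z : Type*} [Fintype Z] (s : Set ι) (f : ι → Z → ℝ≥0∞)
    (h0 : ∑ z, ⨆ i ∈ s, f i z ≠ 0) (htop : ∑ z, ⨆ i ∈ s, f i z ≠ ⊤) :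
    (⨅ μ : {μ : Z → ℝ≥0∞ // ∑ z, μ z = 1}, ⨆ i ∈ s, ⨆ z, f i z / μ.1 z)
      = ∑ z, ⨆ i ∈ s, f i z := by
  apply le_antisymm
  · set S := ∑ z, ⨆ i ∈ s, f i z with hS
    have hμ : ∑ z, (⨆ i ∈ s, f i z) / S = 1 := by
      simp only [div_eq_mul_inv]
      rw [← Finset.sum_mul, ← hS, ENNReal.mul_inv_cancel h0 htop]
    refine iInf_le_of_le ⟨fun z => (⨆ i ∈ s, f i z) / S, hμ⟩ ?_
    refine iSup₂_le fun i hi => iSup_le fun z => ENNReal.div_le_of_le_mul ?_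
    rw [ENNReal.mul_div_cancel h0 htop]
    exact le_iSup₂ (f := fun i (_ : i ∈ s) => f i z) i hi
  · refine le_iInf fun ⟨μ, hμ⟩ => ?_
    set c := ⨆ i ∈ s, ⨆ z, f i z / μ z with hc
    rcases eq_or_ne c ⊤ with hct | hct
    · simp [hct]
    have hμtop (z : Z) : μ z ≠ ⊤ :=
      ne_top_of_le_ne_top ENNReal.one_ne_top
        (hμ ▸ Finset.single_le_sum (fun _ _ => zero_le) (Finset.mem_univ z))
    calc ∑ z, ⨆ i ∈ s, f i z ≤ ∑ z, c * μ z := by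
          refine Finset.sum_le_sum fun z _ => iSup₂_le fun i hi => ?_
          rw [← ENNReal.div_le_iff_le_mul (Or.inr hct) (Or.inl (hμtop z))]
          exact (le_iSup (fun z => f i z / μ z) z).trans
            (le_iSup₂ (f := fun i (_ : i ∈ s) => ⨆ z, f i z / μ z) i hi)
      _ = c := by rw [← Finset.mul_sum, hμ, mul_one]

/-- For a finite MDP `M` and a nonempty set of policies `Π`, for every
layer `h ∈ [H]` (0-indexed: `h < H`),
`inf_{μ∈Δ(Z)} sup_{π∈Π} sup_z d^{M,π}_h(z)/μ(z) = Σ_z sup_{π∈Π} d^{M,π}_h(z)`,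
with ratios in `ℝ≥0∞` (so `c/0 = ∞` for `c > 0`, `0/0 = 0`). -/
theorem statement4 (Z A : Type*) [Fintype Z] [Fintype A] [Nonempty Z] [Nonempty A]
    (H : ℕ) (hH : 0 < H)
    (P0 : Z → ℝ) (hP00 : ∀ z, 0 ≤ P0 z) (hP01 : ∑ z, P0 z = 1)
    (P : ℕ → Z → A → Z → ℝ)
    (hPnn : ∀ h, h + 1 < H → ∀ z a z', 0 ≤ P h z a z')
    (hPsum : ∀ h, h + 1 < H → ∀ z a, ∑ z', P h z a z' = 1)
    (Pol : Set (ℕ → Z → A → ℝ)) (hne : Pol.Nonempty)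
    (hval : ∀ π ∈ Pol, ∀ h, h < H → ∀ z, (∀ a, 0 ≤ π h z a) ∧ ∑ a, π h z a = 1)
    (h : ℕ) (hh : h < H) :
    (⨅ μ : {μ : Z → ℝ≥0∞ // ∑ z, μ z = 1},
        ⨆ π ∈ Pol, ⨆ z : Z, ENNReal.ofReal (docc P0 P π h z) / μ.1 z)
      = ∑ z : Z, ⨆ π ∈ Pol, ENNReal.ofReal (docc P0 P π h z) := by
  have hd : ∀ π ∈ Pol, (∀ z, 0 ≤ docc P0 P π h z) ∧ ∑ z, docc P0 P π h z = 1 := fun π hπ =>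
    docc_nonneg_and_sum_eq_one hP00 hP01 h (fun k hk => hPnn k (by omega))
      (fun k hk => hPsum k (by omega)) (fun k hk => hval π hπ k (by omega))
  apply iInf_iSup_div_eq_sum_iSup Pol (fun π z => ENNReal.ofReal (docc P0 P π h z))
  · obtain ⟨π, hπ⟩ := hne
    refine (zero_lt_one.trans_le ?_).ne'
    calc (1 : ℝ≥0∞) = ∑ z, ENNReal.ofReal (docc P0 P π h z) := by
          rw [← ENNReal.ofReal_sum_of_nonneg fun z _ => (hd π hπ).1 z, (hd π hπ).2,
            ENNReal.ofReal_one]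
      _ ≤ _ := Finset.sum_le_sum fun z _ =>
          le_iSup₂ (f := fun π (_ : π ∈ Pol) => ENNReal.ofReal (docc P0 P π h z)) π hπ
  · refine ENNReal.sum_ne_top.2 fun z _ => ne_top_of_le_ne_top ENNReal.one_ne_top ?_
    refine iSup₂_le fun π hπ => ENNReal.ofReal_le_one.2 ?_
    rw [← (hd π hπ).2]
    exact Finset.single_le_sum (fun z _ => (hd π hπ).1 z) (Finset.mem_univ z)
end

section
/- Let M be a finite MDP over finite state space Z and finite action space A with horizon H, and let Π_rns be the set of all randomized non-stationary policies. Then C_cov(M, Π_rns) ≤ C_push(M)·|A|. -/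
open Finset ENNReal

section Occupancy

variable {Z A : Type*} [Fintype Z] [Fintype A] {H : ℕ} {P0 : Z → ℝ}
  {P : ℕ → Z → A → Z → ℝ} {pol : ℕ → Z → A → ℝ}

theorem docc_nonneg (hP00 : ∀ z, 0 ≤ P0 z)
    (hPnn : ∀ h, h + 1 < H → ∀ z a z', 0 ≤ P h z a z')
    (hpol : ∀ h, h < H → ∀ z, (∀ a, 0 ≤ pol h z a) ∧ ∑ a, pol h z a = 1) :
    ∀ h, h < H → ∀ z, 0 ≤ docc P0 P pol h z
  | 0, _, z => hP00 z
  | h + 1, hh, z' => by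
    have hlt : h < H := by omega
    exact Finset.sum_nonneg fun z _ => Finset.sum_nonneg fun a _ =>
      mul_nonneg (mul_nonneg (docc_nonneg hP00 hPnn hpol h hlt z) ((hpol h hlt z).1 a))
        (hPnn h hh z a z')

theorem sum_docc_mul_pol {h : ℕ} (hpol : ∀ z, ∑ a, pol h z a = 1) :
    ∑ z, ∑ a, docc P0 P pol h z * pol h z a = ∑ z, docc P0 P pol h z :=
  Finset.sum_congr rfl fun z _ => by rw [← Finset.mul_sum, hpol z, mul_one]

theorem sum_docc_eq_one (hP01 : ∑ z, P0 z = 1)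
    (hPsum : ∀ h, h + 1 < H → ∀ z a, ∑ z', P h z a z' = 1)
    (hpol : ∀ h, h < H → ∀ z, (∀ a, 0 ≤ pol h z a) ∧ ∑ a, pol h z a = 1) :
    ∀ h, h < H → ∑ z, docc P0 P pol h z = 1
  | 0, _ => hP01
  | h + 1, hh => by
    have hlt : h < H := by omega
    rw [← sum_docc_eq_one hP01 hPsum hpol h hlt,
      ← sum_docc_mul_pol fun z => (hpol h hlt z).2]
    simp only [docc]
    rw [Finset.sum_comm]
    refine Finset.sum_congr rfl fun z _ => ?_
    rw [Finset.sum_comm]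
    refine Finset.sum_congr rfl fun a _ => ?_
    rw [← Finset.mul_sum, hPsum h hh z a, mul_one]

/-- A uniform bound on the transition probabilities into a state bounds its occupancy. -/
theorem docc_le_of_kernel_le [Nonempty Z] [Nonempty A]
    (hP00 : ∀ z, 0 ≤ P0 z) (hP01 : ∑ z, P0 z = 1)
    (hPnn : ∀ h, h + 1 < H → ∀ z a z', 0 ≤ P h z a z')
    (hPsum : ∀ h, h + 1 < H → ∀ z a, ∑ z', P h z a z' = 1)
    (hpol : ∀ h, h < H → ∀ z, (∀ a, 0 ≤ pol h z a) ∧ ∑ a, pol h z a = 1)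
    {h : ℕ} (hh : h < H) {z' : Z} {c : ℝ}
    (hc : ∀ z a, (if h = 0 then P0 z' else P (h - 1) z a z') ≤ c) :
    docc P0 P pol h z' ≤ c := by
  cases h with
  | zero => simpa [docc] using hc (Classical.arbitrary Z) (Classical.arbitrary A)
  | succ h =>
    have hlt : h < H := by omega
    calc docc P0 P pol (h + 1) z'
        ≤ ∑ z, ∑ a, docc P0 P pol h z * pol h z a * c :=
          Finset.sum_le_sum fun z _ => Finset.sum_le_sum fun a _ =>
            mul_le_mul_of_nonneg_left (by simpa using hc z a)
              (mul_nonneg (docc_nonneg hP00 hPnn hpol h hlt z) ((hpol h hlt z).1 a))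
      _ = c := by
          simp only [← Finset.sum_mul]
          rw [sum_docc_mul_pol fun z => (hpol h hlt z).2,
            sum_docc_eq_one hP01 hPsum hpol h hlt, one_mul]

end Occupancy

/-- For a finite MDP `M` with `Π_rns` the set of all randomized
non-stationary policies, `C_cov(M, Π_rns) ≤ C_push(M)·|A|`.  Here
`C_cov(M,Π) = max_{h<H} inf_{μ∈Δ(Z×A)} sup_{π∈Π} sup_{(z,a)} d^{M,π}_h(z,a)/μ(z,a)` and
`C_push(M) = max_{h<H} inf_{μ∈Δ(Z)} sup_{z,a,z'} P_{h−1}(z'|z,a)/μ(z')`, where at the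
first layer `P_{h-1}(z'|z,a)` is interpreted as the initial distribution `P0(z')`.
Ratios are taken in `ℝ≥0∞` (so `c/0 = ∞` for `c > 0`, `0/0 = 0`). -/
theorem statement6 (Z A : Type*) [Fintype Z] [Fintype A] [Nonempty Z] [Nonempty A]
    (H : ℕ) (hH : 0 < H)
    (P0 : Z → ℝ) (hP00 : ∀ z, 0 ≤ P0 z) (hP01 : ∑ z, P0 z = 1)
    (P : ℕ → Z → A → Z → ℝ)
    (hPnn : ∀ h, h + 1 < H → ∀ z a z', 0 ≤ P h z a z')
    (hPsum : ∀ h, h + 1 < H → ∀ z a, ∑ z', P h z a z' = 1) :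
    (⨆ (h : ℕ) (_ : h < H), ⨅ μ : {μ : Z × A → ℝ≥0∞ // ∑ za, μ za = 1},
        ⨆ (π : ℕ → Z → A → ℝ)
          (_ : ∀ h', h' < H → ∀ z, (∀ a, 0 ≤ π h' z a) ∧ ∑ a, π h' z a = 1),
          ⨆ z : Z, ⨆ a : A,
            ENNReal.ofReal (docc P0 P π h z * π h z a) / μ.1 (z, a))
      ≤ (⨆ (h : ℕ) (_ : h < H), ⨅ μ : {μ : Z → ℝ≥0∞ // ∑ z, μ z = 1},
          ⨆ z : Z, ⨆ a : A, ⨆ z' : Z,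
            ENNReal.ofReal (if h = 0 then P0 z' else P (h - 1) z a z') / μ.1 z')
        * (Fintype.card A : ℝ≥0∞) := by
  have hA0 : (Fintype.card A : ℝ≥0∞) ≠ 0 := by simp
  have hAt : (Fintype.card A : ℝ≥0∞) ≠ ⊤ := ENNReal.natCast_ne_top _
  refine iSup₂_le fun h hh => ?_
  refine le_trans ?_ (mul_le_mul_left (le_iSup₂ (f := fun (h : ℕ) (_ : h < H) =>
    ⨅ μ : {μ : Z → ℝ≥0∞ // ∑ z, μ z = 1}, ⨆ z : Z, ⨆ a : A, ⨆ z' : Z,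
      ENNReal.ofReal (if h = 0 then P0 z' else P (h - 1) z a z') / μ.1 z') h hh) _)
  rw [ENNReal.iInf_mul_of_ne hA0 hAt]
  refine le_iInf fun μ => ?_
  set S := ⨆ z : Z, ⨆ a : A, ⨆ z' : Z,
    ENNReal.ofReal (if h = 0 then P0 z' else P (h - 1) z a z') / μ.1 z' with hS
  by_cases hSt : S = ⊤
  · simp [hSt, ENNReal.top_mul hA0]
  have hμt : ∀ z, μ.1 z ≠ ⊤ := fun z =>
    ne_top_of_le_ne_top ENNReal.one_ne_top
      ((Finset.single_le_sum (f := μ.1) (fun _ _ => zero_le) (Finset.mem_univ z)).trans_eq μ.2)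
  have hker : ∀ z' z a,
      (if h = 0 then P0 z' else P (h - 1) z a z') ≤ (S * μ.1 z').toReal := by
    intro z' z a
    rw [← ENNReal.ofReal_le_iff_le_toReal (ENNReal.mul_ne_top hSt (hμt z')),
      ← ENNReal.div_le_iff_le_mul (Or.inr hSt) (Or.inl (hμt z'))]
    exact le_iSup_of_le z (le_iSup_of_le a (le_iSup_of_le z' le_rfl))
  refine iInf_le_of_le ⟨fun za => μ.1 za.1 / Fintype.card A, ?_⟩ ?_
  · rw [Fintype.sum_prod_type]
    simp only [Finset.sum_const, Finset.card_univ, nsmul_eq_mul]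
    simp only [ENNReal.mul_div_cancel hA0 hAt, μ.2]
  · refine iSup₂_le fun π hπ => iSup_le fun z => iSup_le fun a => ?_
    apply ENNReal.div_le_of_le_mul
    rw [mul_assoc, ENNReal.mul_div_cancel hA0 hAt,
      ENNReal.ofReal_le_iff_le_toReal (ENNReal.mul_ne_top hSt (hμt z))]
    have hπ1 : π h z a ≤ 1 :=
      (Finset.single_le_sum (fun b _ => (hπ h hh z).1 b) (Finset.mem_univ a)).trans_eq
        (hπ h hh z).2
    exact (mul_le_of_le_one_right (docc_nonneg hP00 hPnn hπ h hh z) hπ1).trans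
      (docc_le_of_kernel_le hP00 hP01 hPnn hPsum hπ hh (hker z))
end

section
/- Let M_lat be a base MDP over finite latent state space S and finite action space A with horizon H, let ψ* be a decodable emission process into a finite observation space X with decoder φ*, and let M_obs = ⟨M_lat, ψ*⟩ be the induced latent-dynamics MDP over X. Then C_push(M_obs) = C_push(M_lat). Moreover, if μ_lat = {μ_lat,h ∈ Δ(S)}_{h∈[H]} attains C_push(M_lat), then the distributions μ_obs,h(x) = ψ*_h(x|φ*_h(x))·μ_lat,h(φ*_h(x)) attain C_push(M_obs). -/
open Finset ENNReal

attribute [local instance] Classical.propDecidable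

/-- Initial distribution of the latent-dynamics MDP `⟨M_lat, ψ⟩`:
`P_obs,0(x) = P_lat,0(φ*_1(x))·ψ_1(x|φ*_1(x))` (layers 0-indexed).
Here `ψ h s x` denotes `ψ_h(x|s)`. -/
noncomputable def obsInit {S X : Type*} (P0lat : S → ℝ) (ψ : ℕ → S → X → ℝ)
    (φstar : ℕ → X → S) : X → ℝ :=
  fun x => P0lat (φstar 0 x) * ψ 0 (φstar 0 x) x

/-- Transition kernel of the latent-dynamics MDP `⟨M_lat, ψ⟩`:
`P_obs,h(x'|x,a) = P_lat,h(φ*_{h+1}(x')|φ*_h(x),a)·ψ_{h+1}(x'|φ*_{h+1}(x'))`. -/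
noncomputable def obsTrans {S X A : Type*} (Plat : ℕ → S → A → S → ℝ)
    (ψ : ℕ → S → X → ℝ) (φstar : ℕ → X → S) : ℕ → X → A → X → ℝ :=
  fun h x a x' => Plat h (φstar h x) a (φstar (h + 1) x') * ψ (h + 1) (φstar (h + 1) x') x'

/-- The sup of the pushforward density ratios of a kernel `K` relative to `ν`. -/
noncomputable def pushRatio {Z A : Type*} (K : Z → A → Z → ℝ≥0∞) (ν : Z → ℝ≥0∞) : ℝ≥0∞ :=
  ⨆ z, ⨆ a, ⨆ z', K z a z' / ν z'

section RichObservation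

variable {S X A : Type*} {K : S → A → S → ℝ≥0∞} {e : S → X → ℝ≥0∞} {f g : X → S}

lemma exists_emission_ne_zero [Fintype X] (hsum : ∀ s, ∑ x, e s x = 1) (s : S) :
    ∃ x, e s x ≠ 0 := by
  by_contra! h
  simpa [h] using hsum s

lemma decoder_surjective [Fintype X] (hsum : ∀ s, ∑ x, e s x = 1)
    (hf : ∀ s x, e s x ≠ 0 → f x = s) : Function.Surjective f := fun s =>
  (exists_emission_ne_zero hsum s).imp fun x hx => hf s x hx

lemma sum_fiber_emission [Fintype X] (hsum : ∀ s, ∑ x, e s x = 1)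
    (hf : ∀ s x, e s x ≠ 0 → f x = s) (s : S) :
    ∑ x with f x = s, e s x = 1 := by
  rw [← hsum s]
  exact sum_filter_of_ne fun x _ hx => hf s x hx

lemma sum_emission_mul [Fintype S] [Fintype X] (hsum : ∀ s, ∑ x, e s x = 1)
    (hf : ∀ s x, e s x ≠ 0 → f x = s) (ν : S → ℝ≥0∞) :
    ∑ x, e (f x) x * ν (f x) = ∑ s, ν s := by
  rw [← sum_fiberwise univ f]
  refine sum_congr rfl fun s _ => ?_
  rw [sum_congr rfl (g := fun x => e s x * ν s) fun x hx => by rw [(mem_filter.1 hx).2],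
    ← sum_mul, sum_fiber_emission hsum hf, one_mul]

lemma emission_ne_top [Fintype X] (hsum : ∀ s, ∑ x, e s x = 1) (s : S) (x : X) :
    e s x ≠ ∞ :=
  ENNReal.sum_ne_top.1 (by simp [hsum s]) x (mem_univ x)

lemma pushRatio_emission [Fintype X] (hsum : ∀ s, ∑ x, e s x = 1)
    (hf : ∀ s x, e s x ≠ 0 → f x = s) (hg : Function.Surjective g) (ν : S → ℝ≥0∞) :
    pushRatio (fun x a x' => K (g x) a (f x') * e (f x') x') (fun x => e (f x) x * ν (f x))
      = pushRatio K ν := by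
  have cancel (s a s') (x : X) (hx : e s' x ≠ 0) :
      K s a s' * e s' x / (e s' x * ν s') = K s a s' / ν s' := by
    rw [mul_comm (K s a s')]
    exact ENNReal.mul_div_mul_left _ _ hx (emission_ne_top hsum s' x)
  apply le_antisymm
  · refine iSup_le fun x => iSup_le fun a => iSup_le fun x' => ?_
    rcases eq_or_ne (e (f x') x') 0 with h | h
    · simp [h]
    · dsimp only
      rw [cancel _ _ _ _ h]
      exact le_iSup_of_le (g x) <| le_iSup_of_le a <| le_iSup_of_le (f x') le_rfl
  · refine iSup_le fun s => iSup_le fun a => iSup_le fun s' => ?_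
    obtain ⟨x, rfl⟩ := hg s
    obtain ⟨x', hx'⟩ := exists_emission_ne_zero hsum s'
    obtain rfl := hf s' x' hx'
    rw [← cancel _ _ _ _ hx']
    exact le_iSup_of_le x <| le_iSup_of_le a <| le_iSup_of_le x' le_rfl

lemma pushRatio_fiberSum_le [Fintype X] (hsum : ∀ s, ∑ x, e s x = 1)
    (hf : ∀ s x, e s x ≠ 0 → f x = s) (hg : Function.Surjective g)
    (μ : X → ℝ≥0∞) (hμ : ∀ x, μ x ≠ ∞) :
    pushRatio K (fun s => ∑ x with f x = s, μ x)
      ≤ pushRatio (fun x a x' => K (g x) a (f x') * e (f x') x') μ := by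
  set C := pushRatio (fun x a x' => K (g x) a (f x') * e (f x') x') μ
  rcases eq_or_ne C ∞ with htop | htop
  · simp [htop]
  refine iSup_le fun s => iSup_le fun a => iSup_le fun s' => ENNReal.div_le_of_le_mul ?_
  obtain ⟨y, rfl⟩ := hg s
  calc K (g y) a s' = ∑ x with f x = s', K (g y) a s' * e s' x := by
        rw [← mul_sum, sum_fiber_emission hsum hf, mul_one]
    _ ≤ ∑ x with f x = s', C * μ x := by
        refine sum_le_sum fun x hx => ?_
        obtain rfl := (mem_filter.1 hx).2
        refine (ENNReal.div_le_iff_le_mul (.inr htop) (.inl (hμ x))).1 ?_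
        exact le_iSup_of_le y <| le_iSup_of_le a <| le_iSup_of_le x le_rfl
    _ = C * ∑ x with f x = s', μ x := (mul_sum ..).symm

lemma iInf_pushRatio_emission [Fintype S] [Fintype X] (hsum : ∀ s, ∑ x, e s x = 1)
    (hf : ∀ s x, e s x ≠ 0 → f x = s) (hg : Function.Surjective g) :
    ⨅ μ : {μ : X → ℝ≥0∞ // ∑ x, μ x = 1},
        pushRatio (fun x a x' => K (g x) a (f x') * e (f x') x') μ.1
      = ⨅ ν : {ν : S → ℝ≥0∞ // ∑ s, ν s = 1}, pushRatio K ν.1 := by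
  apply le_antisymm
  · exact le_iInf fun ν => iInf_le_of_le
      ⟨fun x => e (f x) x * ν.1 (f x), (sum_emission_mul hsum hf ν.1).trans ν.2⟩
      (pushRatio_emission hsum hf hg ν.1).le
  · exact le_iInf fun μ => iInf_le_of_le
      ⟨fun s => ∑ x with f x = s, μ.1 x, (sum_fiberwise univ f μ.1).trans μ.2⟩
      (pushRatio_fiberSum_le hsum hf hg μ.1 fun x =>
        ENNReal.sum_ne_top.1 (by simp [μ.2]) x (mem_univ x))

end RichObservation

/-- Pushforward coverability is invariant to rich observations:
`C_push(M_obs) = C_push(M_lat)` where `M_obs = ⟨M_lat, ψ*⟩` for a decodable emission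
`ψ*` with decoder `φ*`.  Moreover, if `μ_lat,h` attains `C_push(M_lat)` (is a minimizer
at every layer), then `μ_obs,h(x) = ψ*_h(x|φ*_h(x))·μ_lat,h(φ*_h(x))` is a probability
distribution attaining `C_push(M_obs)`.
`C_push(M) = max_{h<H} inf_{μ∈Δ(Z)} sup_{z,a,z'} P_{h−1}(z'|z,a)/μ(z')` with
`P_{h-1} := ` initial distribution at the first layer; ratios in `ℝ≥0∞`. -/
theorem statement7 (S X A : Type*) [Fintype S] [Fintype X] [Fintype A]
    [Nonempty S] [Nonempty X] [Nonempty A]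
    (H : ℕ) (hH : 0 < H)
    (P0lat : S → ℝ) (h00 : ∀ s, 0 ≤ P0lat s) (h01 : ∑ s, P0lat s = 1)
    (Plat : ℕ → S → A → S → ℝ)
    (hPnn : ∀ h, h + 1 < H → ∀ s a s', 0 ≤ Plat h s a s')
    (hPsum : ∀ h, h + 1 < H → ∀ s a, ∑ s', Plat h s a s' = 1)
    (ψ : ℕ → S → X → ℝ)
    (hψnn : ∀ h, h < H → ∀ s x, 0 ≤ ψ h s x)
    (hψsum : ∀ h, h < H → ∀ s, ∑ x, ψ h s x = 1)
    (hdec : ∀ h, h < H → ∀ s s' x, s ≠ s' → ψ h s x ≠ 0 → ψ h s' x = 0)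
    (φstar : ℕ → X → S)
    (hφstar : ∀ h, h < H → ∀ s x, ψ h s x ≠ 0 → φstar h x = s) :
    (⨆ (h : ℕ) (_ : h < H), ⨅ μ : {μ : X → ℝ≥0∞ // ∑ x, μ x = 1},
        ⨆ x : X, ⨆ a : A, ⨆ x' : X,
          ENNReal.ofReal (if h = 0 then obsInit P0lat ψ φstar x'
              else obsTrans Plat ψ φstar (h - 1) x a x') / μ.1 x')
      = (⨆ (h : ℕ) (_ : h < H), ⨅ μ : {μ : S → ℝ≥0∞ // ∑ s, μ s = 1},
          ⨆ s : S, ⨆ a : A, ⨆ s' : S,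
            ENNReal.ofReal (if h = 0 then P0lat s' else Plat (h - 1) s a s') / μ.1 s')
    ∧ ∀ μlat : ℕ → S → ℝ≥0∞,
        (∀ h, h < H → ∑ s, μlat h s = 1) →
        (∀ h, h < H →
          (⨆ s : S, ⨆ a : A, ⨆ s' : S,
              ENNReal.ofReal (if h = 0 then P0lat s' else Plat (h - 1) s a s') / μlat h s')
            = ⨅ μ : {μ : S → ℝ≥0∞ // ∑ s, μ s = 1},
                ⨆ s : S, ⨆ a : A, ⨆ s' : S,
                  ENNReal.ofReal (if h = 0 then P0lat s' else Plat (h - 1) s a s') / μ.1 s') →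
        ∀ h, h < H →
          (∑ x, ENNReal.ofReal (ψ h (φstar h x) x) * μlat h (φstar h x) = 1)
          ∧ (⨆ x : X, ⨆ a : A, ⨆ x' : X,
              ENNReal.ofReal (if h = 0 then obsInit P0lat ψ φstar x'
                  else obsTrans Plat ψ φstar (h - 1) x a x')
                / (ENNReal.ofReal (ψ h (φstar h x') x') * μlat h (φstar h x')))
            = ⨅ μ : {μ : X → ℝ≥0∞ // ∑ x, μ x = 1},
                ⨆ x : X, ⨆ a : A, ⨆ x' : X,
                  ENNReal.ofReal (if h = 0 then obsInit P0lat ψ φstar x'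
                      else obsTrans Plat ψ φstar (h - 1) x a x') / μ.1 x' := by
  have esum (h) (hh : h < H) (s : S) : ∑ x, ENNReal.ofReal (ψ h s x) = 1 := by
    rw [← ENNReal.ofReal_sum_of_nonneg fun x _ => hψnn h hh s x, hψsum h hh, ENNReal.ofReal_one]
  have dec (h) (hh : h < H) (s : S) (x : X) (hx : ENNReal.ofReal (ψ h s x) ≠ 0) :
      φstar h x = s :=
    hφstar h hh s x fun h0 => hx (by simp [h0])
  have surj (h) (hh : h < H) : Function.Surjective (φstar (h - 1)) :=
    decoder_surjective (esum _ (by omega)) (dec _ (by omega))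
  have kernel_eq (h) (hh : h < H) (x : X) (a : A) (x' : X) :
      ENNReal.ofReal (if h = 0 then obsInit P0lat ψ φstar x'
          else obsTrans Plat ψ φstar (h - 1) x a x')
        = ENNReal.ofReal (if h = 0 then P0lat (φstar h x')
            else Plat (h - 1) (φstar (h - 1) x) a (φstar h x'))
          * ENNReal.ofReal (ψ h (φstar h x') x') := by
    rw [← ENNReal.ofReal_mul' (hψnn h hh _ _)]
    cases h <;> simp [obsInit, obsTrans]
  let K (h : ℕ) (s : S) (a : A) (s' : S) : ℝ≥0∞ :=
    ENNReal.ofReal (if h = 0 then P0lat s' else Plat (h - 1) s a s')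
  have layer (h) (hh : h < H) := iInf_pushRatio_emission (K := K h) (esum h hh) (dec h hh)
    (surj h hh)
  refine ⟨iSup_congr fun h => iSup_congr fun hh => ?_, fun μlat hμ hmin h hh => ⟨?_, ?_⟩⟩
  · simp only [kernel_eq h hh]
    exact layer h hh
  · rw [← hμ h hh]
    exact sum_emission_mul (e := fun s x => ENNReal.ofReal (ψ h s x)) (esum h hh)
      (dec h hh) (μlat h)
  · simp only [kernel_eq h hh]
    exact (pushRatio_emission (K := K h) (esum h hh) (dec h hh) (surj h hh) (μlat h)).trans
      ((hmin h hh).trans (layer h hh).symm)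
end

section
/- Let M_lat be a base MDP over finite latent state space S and finite action space A with horizon H, let ψ* be a decodable emission process into a finite observation space X with decoder φ*, and let M_obs = ⟨M_lat, ψ*⟩. Then for every latent policy π_lat, every map φ = {φ_h : X → S}, every h ∈ [H], and every x ∈ X: d^{M_obs, π_lat∘φ}_h(x) = ψ*_h(x|φ*_h(x))·d^{M_lat, Γ_φ∘π_lat}_h(φ*_h(x)). -/
open Finset

attribute [local instance] Classical.propDecidable

/-- Composition `π_lat ∘ φ`: `(π_lat∘φ)_h(a|x) = π_lat,h(a|φ_h(x))`. -/
def compPol {S X A : Type*} (pol : ℕ → S → A → ℝ) (φ : ℕ → X → S) : ℕ → X → A → ℝ :=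
  fun h x a => pol h (φ h x) a

/-- Mismatch function `Γ_{φ,h}(s'|s) = Σ_{x : φ_h(x)=s'} ψ_h(x|s)`. -/
noncomputable def mismatch {S X : Type*} [Fintype X] [DecidableEq S]
    (ψ : ℕ → S → X → ℝ) (φ : ℕ → X → S) : ℕ → S → S → ℝ :=
  fun h s s' => ∑ x ∈ Finset.univ.filter (fun x => φ h x = s'), ψ h s x

/-- `(Γ_φ∘π_lat)_h(a|s) = Σ_{s'} Γ_{φ,h}(s'|s)·π_lat,h(a|s')`. -/
noncomputable def mismatchPol {S X A : Type*} [Fintype X] [Fintype S] [DecidableEq S]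
    (ψ : ℕ → S → X → ℝ) (φ : ℕ → X → S) (pol : ℕ → S → A → ℝ) : ℕ → S → A → ℝ :=
  fun h s a => ∑ s', mismatch ψ φ h s s' * pol h s' a

/-- The mismatched policy averages the composed policy over the emitted observations. -/
lemma mismatchPol_eq_sum {S X A : Type*} [Fintype X] [Fintype S] [DecidableEq S]
    (ψ : ℕ → S → X → ℝ) (φ : ℕ → X → S) (pol : ℕ → S → A → ℝ) (h : ℕ) (s : S) (a : A) :
    mismatchPol ψ φ pol h s a = ∑ x, ψ h s x * compPol pol φ h x a := by
  simp only [mismatchPol, mismatch, compPol, Finset.sum_mul, Finset.sum_filter]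
  rw [Finset.sum_comm]
  simp [ite_mul]

/-- Each observation receives mass only from its decoded state. -/
lemma sum_emission_mul_eq {S X : Type*} [Fintype S] {e : S → X → ℝ} {dec : X → S}
    (hdec : ∀ s x, e s x ≠ 0 → dec x = s) (F : S → ℝ) (x : X) :
    ∑ s, e s x * F s = e (dec x) x * F (dec x) := by
  refine Finset.sum_eq_single (dec x) (fun s _ hs => ?_) (by simp)
  rw [not_not.mp fun hne => hs (hdec s x hne).symm, zero_mul]

/-- For every latent policy `π_lat`, map `φ`, layer `h ∈ [H]`
(0-indexed: `h < H`), and observation `x`: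
`d^{M_obs, π_lat∘φ}_h(x) = ψ*_h(x|φ*_h(x)) · d^{M_lat, Γ_φ∘π_lat}_h(φ*_h(x))`,
where `M_obs = ⟨M_lat, ψ*⟩` for a decodable emission `ψ*` with decoder `φ*`. -/
theorem statement9 (S X A : Type*) [Fintype S] [Fintype X] [Fintype A] [DecidableEq S]
    [Nonempty S] [Nonempty X] [Nonempty A]
    (H : ℕ) (hH : 0 < H)
    (P0lat : S → ℝ) (h00 : ∀ s, 0 ≤ P0lat s) (h01 : ∑ s, P0lat s = 1)
    (Plat : ℕ → S → A → S → ℝ)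
    (hPnn : ∀ h, h + 1 < H → ∀ s a s', 0 ≤ Plat h s a s')
    (hPsum : ∀ h, h + 1 < H → ∀ s a, ∑ s', Plat h s a s' = 1)
    (ψ : ℕ → S → X → ℝ)
    (hψnn : ∀ h, h < H → ∀ s x, 0 ≤ ψ h s x)
    (hψsum : ∀ h, h < H → ∀ s, ∑ x, ψ h s x = 1)
    (hdec : ∀ h, h < H → ∀ s s' x, s ≠ s' → ψ h s x ≠ 0 → ψ h s' x = 0)
    (φstar : ℕ → X → S)
    (hφstar : ∀ h, h < H → ∀ s x, ψ h s x ≠ 0 → φstar h x = s)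
    (π : ℕ → S → A → ℝ)
    (hπ : ∀ h, h < H → ∀ s, (∀ a, 0 ≤ π h s a) ∧ ∑ a, π h s a = 1)
    (φ : ℕ → X → S) (h : ℕ) (hh : h < H) (x : X) :
    docc (obsInit P0lat ψ φstar) (obsTrans Plat ψ φstar) (compPol π φ) h x
      = ψ h (φstar h x) x * docc P0lat Plat (mismatchPol ψ φ π) h (φstar h x) := by
  induction h generalizing x with
  | zero => exact mul_comm _ _
  | succ h ih =>
    have hlt : h < H := Nat.lt_of_succ_lt hh
    simp only [docc, ih hlt, obsTrans, mismatchPol_eq_sum]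
    set s' := φstar (h + 1) x
    set d := docc P0lat Plat (mismatchPol ψ φ π) h
    calc
      _ = ∑ z, ψ h (φstar h z) z * ∑ a, d (φstar h z) * compPol π φ h z a *
            (Plat h (φstar h z) a s' * ψ (h + 1) s' x) := by
          simp only [Finset.mul_sum, mul_assoc]
      _ = ∑ z, ∑ s, ψ h s z * ∑ a, d s * compPol π φ h z a *
            (Plat h s a s' * ψ (h + 1) s' x) :=
          Finset.sum_congr rfl fun z _ => (sum_emission_mul_eq (hφstar h hlt)
            (fun s => ∑ a, d s * compPol π φ h z a * (Plat h s a s' * ψ (h + 1) s' x)) z).symm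
      _ = _ := by
          rw [Finset.sum_comm]
          simp only [Finset.mul_sum, Finset.sum_mul]
          refine Finset.sum_congr rfl fun s _ => ?_
          rw [Finset.sum_comm]
          refine Finset.sum_congr rfl fun a _ => Finset.sum_congr rfl fun z _ => ?_
          ring
end

section
/- Let M_lat be a base MDP over finite latent state space S and finite action space A with horizon H, let ψ* be a decodable emission process into a finite observation space X with decoder φ*, and let M_obs = ⟨M_lat, ψ*⟩. Then for every map φ = {φ_h : X → S}, every function f_lat : S × A → ℝ, every h ∈ [H−1], and every (x,a) ∈ X × A: [T^{M_obs}_h (f_lat∘φ_{h+1})](x,a) = [T^{M_lat}_h (Γ_{φ,h+1}∘V_{f_lat})](φ*_h(x), a), where (f_lat∘φ_{h+1})(x',a') = f_lat(φ_{h+1}(x'),a'), V_{f_lat}(s) = max_a f_lat(s,a), and (Γ_{φ,h+1}∘V_{f_lat})(s) = Σ_{s'} Γ_{φ,h+1}(s'|s)·V_{f_lat}(s'). -/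
open Finset

attribute [local instance] Classical.propDecidable

/-- `V_f(z) = max_a f(z,a)` for a finite nonempty action set. -/
noncomputable def maxV {Z A : Type*} [Fintype A] [Nonempty A] (f : Z → A → ℝ) (z : Z) : ℝ :=
  Finset.univ.sup' Finset.univ_nonempty (fun a => f z a)

/-- Averaging `g` over the mismatch function is averaging `g ∘ φ_h` over the emission. -/
theorem sum_mismatch_mul {S X : Type*} [Fintype S] [Fintype X] [DecidableEq S]
    (ψ : ℕ → S → X → ℝ) (φ : ℕ → X → S) (h : ℕ) (s : S) (g : S → ℝ) :
    ∑ s', mismatch ψ φ h s s' * g s' = ∑ x, ψ h s x * g (φ h x) := by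
  rw [← Finset.sum_fiberwise Finset.univ (φ h)]
  refine Finset.sum_congr rfl fun s' _ => ?_
  rw [mismatch, Finset.sum_mul]
  refine Finset.sum_congr (by ext; simp) fun x hx => ?_
  rw [(Finset.mem_filter.mp hx).2]

/-- The mismatch functions express observation-level Bellman backups of
composed functions as latent backups: for every map `φ`, every `f_lat : S × A → ℝ`, every
`h ∈ [H−1]` (0-indexed: `h + 1 < H`), and every `(x,a)`:
`[T^{M_obs}_h (f_lat∘φ_{h+1})](x,a) = [T^{M_lat}_h (Γ_{φ,h+1}∘V_{f_lat})](φ*_h(x),a)`,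
both sides written out via the Bellman backup `[T_h g](z,a) = r_h(z,a) + Σ_{z'} P_h(z'|z,a)g(z')`
(with `V_g(x') = max_{a'} g(x',a')` on the left), and where `M_obs = ⟨M_lat, ψ*⟩` and
`r_obs,h(x,a) = r_lat,h(φ*_h(x),a)`. -/
theorem statement10 (S X A : Type*) [Fintype S] [Fintype X] [Fintype A] [DecidableEq S]
    [Nonempty S] [Nonempty X] [Nonempty A]
    (H : ℕ) (hH : 0 < H)
    (rlat : ℕ → S → A → ℝ) (hr : ∀ h, h < H → ∀ s a, rlat h s a ∈ Set.Icc (0:ℝ) 1)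
    (P0lat : S → ℝ) (h00 : ∀ s, 0 ≤ P0lat s) (h01 : ∑ s, P0lat s = 1)
    (Plat : ℕ → S → A → S → ℝ)
    (hPnn : ∀ h, h + 1 < H → ∀ s a s', 0 ≤ Plat h s a s')
    (hPsum : ∀ h, h + 1 < H → ∀ s a, ∑ s', Plat h s a s' = 1)
    (ψ : ℕ → S → X → ℝ)
    (hψnn : ∀ h, h < H → ∀ s x, 0 ≤ ψ h s x)
    (hψsum : ∀ h, h < H → ∀ s, ∑ x, ψ h s x = 1)
    (hdec : ∀ h, h < H → ∀ s s' x, s ≠ s' → ψ h s x ≠ 0 → ψ h s' x = 0)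
    (φstar : ℕ → X → S)
    (hφstar : ∀ h, h < H → ∀ s x, ψ h s x ≠ 0 → φstar h x = s)
    (φ : ℕ → X → S) (flat : S → A → ℝ)
    (h : ℕ) (hh : h + 1 < H) (x : X) (a : A) :
    rlat h (φstar h x) a
        + ∑ x', obsTrans Plat ψ φstar h x a x' * maxV flat (φ (h + 1) x')
      = rlat h (φstar h x) a
        + ∑ s', Plat h (φstar h x) a s' *
            ∑ s'', mismatch ψ φ (h + 1) s' s'' * maxV flat s'' := by
  congr 1
  simp only [sum_mismatch_mul, Finset.mul_sum]
  rw [Finset.sum_comm]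
  refine Finset.sum_congr rfl fun x' _ => ?_
  rw [Finset.sum_eq_single (φstar (h + 1) x')]
  · simp only [obsTrans, mul_assoc]
  · intro s _ hs
    have : ψ (h + 1) s x' = 0 := by
      by_contra hne
      exact hs (hφstar (h + 1) hh s x' hne).symm
    simp [this]
  · simp
end

section
/- Consider the construction described in the context (N disjoint binary trees with shifted deterministic emissions). For every ε with ε² ≥ 4/N, the constrained PAC Decision-Estimation Coefficient satisfies dec_ε(M, M̄) ≥ 1/2. -/
open Finset MeasureTheory

attribute [local instance] Classical.propDecidable

namespace TreeLB

/-- Observation (= state) space of the construction: `N = 2^m` disjoint complete binary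
trees of depth `H = m+1`, with nodes in heap order.  A state `(c, k)` is node `k`
(heap index, root `k = 1`, children of `k` are `2k, 2k+1`; node `k` lies at layer
`⌊log₂ k⌋`; leaves are `k ∈ [2^m, 2^{m+1})`) of the tree with index `c ∈ [N]`. -/
abbrev Obs (m : ℕ) := Fin (2 ^ m) × Fin (2 ^ (m + 1))

/-- Randomized non-stationary policies over the horizon `H = m + 1`:
`π_h(a|x)` for `h ∈ [H]`, `x ∈ X`, `a ∈ {0,1}` (actions encoded as `Bool`). -/
abbrev Pol (m : ℕ) := Fin (m + 1) → Obs m → Bool → ℝ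

/-- A policy is valid if each `π_h(·|x)` is a probability distribution over `{0,1}`. -/
def validPol (m : ℕ) (π : Pol m) : Prop :=
  (∀ h x a, 0 ≤ π h x a) ∧ ∀ h x, ∑ a, π h x a = 1

/-- Deterministic tree dynamics: from node `k`, action `a ∈ {0,1}` leads to child
`2k + a` (the tree index is unchanged). -/
noncomputable def step (m : ℕ) (x : Obs m) (a : Bool) : Obs m :=
  (x.1, ⟨(2 * x.2.val + (if a then 1 else 0)) % 2 ^ (m + 1),
    Nat.mod_lt _ (by positivity)⟩)

/-- Rewards of the latent-dynamics MDP `M^i`: the observation `(c, k)` is a leaf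
(`k = 2^m + j`) relabeled by the cyclic shift `σ_i`, and carries reward `1` iff
`j = c − i (mod N)`, i.e. iff `(j + i) mod N = c`; all other rewards are `0`
(rewards do not depend on the action). -/
noncomputable def rewardOf (m : ℕ) (i : Fin (2 ^ m)) (x : Obs m) : Bool :=
  if 2 ^ m ≤ x.2.val ∧ (x.2.val - 2 ^ m + i.val) % 2 ^ m = x.1.val then true else false

/-- Law of the trajectory `(x_1,a_1,r_1,…,x_H,a_H,r_H)` (0-indexed, `H = m+1`,
rewards deterministic, Boolean-valued) for an MDP with the tree dynamics, uniform
initial distribution over the `N` roots `(c, 1)`, and reward function `rew`. -/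
noncomputable def trajProb (m : ℕ) (rew : Obs m → Bool) (π : Pol m)
    (xs : Fin (m + 1) → Obs m) (as : Fin (m + 1) → Bool)
    (rs : Fin (m + 1) → Bool) : ℝ :=
  if (xs 0).2.val = 1
      ∧ (∀ h : Fin m, xs h.succ = step m (xs h.castSucc) (as h.castSucc))
      ∧ (∀ h : Fin (m + 1), rs h = rew (xs h))
    then (1 / (2 ^ m : ℝ)) * ∏ h : Fin (m + 1), π h (xs h) (as h)
    else 0

/-- Expected cumulative reward `J^M(π)`. -/
noncomputable def valJ (m : ℕ) (rew : Obs m → Bool) (π : Pol m) : ℝ :=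
  ∑ xs : Fin (m + 1) → Obs m, ∑ as : Fin (m + 1) → Bool, ∑ rs : Fin (m + 1) → Bool,
    trajProb m rew π xs as rs * ∑ h : Fin (m + 1), (if rs h then (1 : ℝ) else 0)

/-- Squared Hellinger distance `D²_H(M(π), M̄(π))` between trajectory laws. -/
noncomputable def hellSq (m : ℕ) (rew rew' : Obs m → Bool) (π : Pol m) : ℝ :=
  ∑ xs : Fin (m + 1) → Obs m, ∑ as : Fin (m + 1) → Bool, ∑ rs : Fin (m + 1) → Bool,
    (Real.sqrt (trajProb m rew π xs as rs)
      - Real.sqrt (trajProb m rew' π xs as rs)) ^ 2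

/-- The law of a trajectory of states and actions, for a process with deterministic
dynamics `f` started at `x₀`, has total mass one. -/
theorem sum_prod_policy_eq_one {X : Type*} [Fintype X] (f : X → Bool → X) (n : ℕ)
    (g : Fin (n + 1) → X → Bool → ℝ) (hg : ∀ h x, ∑ a, g h x a = 1) (x₀ : X) :
    ∑ xs : Fin (n + 1) → X, ∑ as : Fin (n + 1) → Bool,
      (if xs 0 = x₀ ∧ ∀ h : Fin n, xs h.succ = f (xs h.castSucc) (as h.castSucc)
        then ∏ h, g h (xs h) (as h) else 0) = 1 := by
  induction n generalizing x₀ with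
  | zero =>
    rw [← (Equiv.funUnique (Fin 1) X).symm.sum_comp]
    simp_rw [← (Equiv.funUnique (Fin 1) Bool).symm.sum_comp]
    simp only [Equiv.funUnique_symm_apply, uniqueElim_const, IsEmpty.forall_iff, and_true]
    rw [Finset.sum_comm]
    simpa using hg 0 x₀
  | succ n ih =>
    rw [← (Fin.consEquiv fun _ => X).sum_comp]
    simp_rw [← (Fin.consEquiv fun _ => Bool).sum_comp]
    simp only [Fin.consEquiv_apply, Fintype.sum_prod_type, Fin.cons_zero, Fin.forall_fin_succ,
      Fin.prod_univ_succ (n := n + 1), Fin.cons_succ, Fin.castSucc_zero,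
      ← Fin.succ_castSucc]
    have key : ∀ x : X, ∑ xs : Fin (n + 1) → X, ∑ a : Bool, ∑ as : Fin (n + 1) → Bool,
        (if x = x₀ ∧ xs 0 = f x a ∧
            ∀ h : Fin n, xs h.succ = f (xs h.castSucc) (as h.castSucc)
          then g 0 x a * ∏ h : Fin (n + 1), g h.succ (xs h) (as h) else 0)
        = if x = x₀ then 1 else 0 := by
      intro x
      by_cases hx : x = x₀
      · have hi : ∀ a, ∑ xs : Fin (n + 1) → X, ∑ as : Fin (n + 1) → Bool,
            (if x = x₀ ∧ xs 0 = f x a ∧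
                ∀ h : Fin n, xs h.succ = f (xs h.castSucc) (as h.castSucc)
              then g 0 x a * ∏ h : Fin (n + 1), g h.succ (xs h) (as h) else 0)
            = g 0 x a := by
          intro a
          have := ih (fun h => g h.succ) (fun h => hg h.succ) (f x a)
          simp only [hx, true_and, ← mul_ite_zero, ← Finset.mul_sum] at this ⊢
          rw [this, mul_one]
        rw [Finset.sum_comm, Finset.sum_congr rfl fun a _ => hi a, hg, if_pos hx]
      · simp [hx]
    refine (Finset.sum_congr rfl fun x _ => key x).trans ?_
    simp

/-- Probability of a sequence of states and actions under `π`. -/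
noncomputable def pathProb (m : ℕ) (π : Pol m)
    (xs : Fin (m + 1) → Obs m) (as : Fin (m + 1) → Bool) : ℝ :=
  if (xs 0).2.val = 1
      ∧ (∀ h : Fin m, xs h.succ = step m (xs h.castSucc) (as h.castSucc))
    then (1 / (2 ^ m : ℝ)) * ∏ h : Fin (m + 1), π h (xs h) (as h)
    else 0

theorem pathProb_nonneg {m : ℕ} {π : Pol m} (hπ : validPol m π)
    (xs : Fin (m + 1) → Obs m) (as : Fin (m + 1) → Bool) : 0 ≤ pathProb m π xs as := by
  unfold pathProb
  split_ifs
  · exact mul_nonneg (by positivity) (Finset.prod_nonneg fun h _ => hπ.1 _ _ _)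
  · exact le_rfl

theorem sum_pathProb {m : ℕ} {π : Pol m} (hπ : validPol m π) :
    ∑ xs : Fin (m + 1) → Obs m, ∑ as : Fin (m + 1) → Bool, pathProb m π xs as = 1 := by
  have h1 : 1 < 2 ^ (m + 1) := Nat.one_lt_two_pow (by omega)
  have split : ∀ (xs : Fin (m + 1) → Obs m) (as : Fin (m + 1) → Bool),
      pathProb m π xs as = (1 / (2 ^ m : ℝ)) * ∑ c : Fin (2 ^ m),
        (if xs 0 = (c, ⟨1, h1⟩)
            ∧ ∀ h : Fin m, xs h.succ = step m (xs h.castSucc) (as h.castSucc)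
          then ∏ h, π h (xs h) (as h) else 0) := by
    intro xs as
    have hroot : ∀ c, xs 0 = (c, ⟨1, h1⟩) ↔ (xs 0).2.val = 1 ∧ (xs 0).1 = c := by
      intro c
      rw [Prod.ext_iff, Fin.ext_iff (b := (⟨1, h1⟩ : Fin _)), and_comm]
    simp only [hroot]
    unfold pathProb
    by_cases hr : (xs 0).2.val = 1 <;>
      by_cases hd : ∀ h : Fin m, xs h.succ = step m (xs h.castSucc) (as h.castSucc) <;>
      simp [hr, hd]
  simp only [split, ← Finset.mul_sum]
  have : ∑ xs : Fin (m + 1) → Obs m, ∑ as : Fin (m + 1) → Bool, ∑ c : Fin (2 ^ m),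
      (if xs 0 = (c, ⟨1, h1⟩)
          ∧ ∀ h : Fin m, xs h.succ = step m (xs h.castSucc) (as h.castSucc)
        then ∏ h, π h (xs h) (as h) else 0) = 2 ^ m := by
    rw [Finset.sum_congr rfl fun xs _ => Finset.sum_comm, Finset.sum_comm]
    refine Eq.trans (b := ∑ _c : Fin (2 ^ m), (1 : ℝ)) (Finset.sum_congr rfl fun c _ => ?_)
      (by simp)
    convert sum_prod_policy_eq_one (step m) m π hπ.2 (c, ⟨1, h1⟩)
  rw [this]
  field_simp

theorem trajProb_eq (m : ℕ) (rew : Obs m → Bool) (π : Pol m)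
    (xs : Fin (m + 1) → Obs m) (as rs : Fin (m + 1) → Bool) :
    trajProb m rew π xs as rs =
      if rs = (fun h => rew (xs h)) then pathProb m π xs as else 0 := by
  unfold trajProb pathProb
  rw [← ite_and]
  refine if_congr ?_ rfl rfl
  rw [funext_iff]
  tauto

theorem valJ_eq (m : ℕ) (rew : Obs m → Bool) (π : Pol m) :
    valJ m rew π = ∑ xs : Fin (m + 1) → Obs m, ∑ as : Fin (m + 1) → Bool,
      pathProb m π xs as * ∑ h, (if rew (xs h) then (1 : ℝ) else 0) := by
  unfold valJ
  refine Finset.sum_congr rfl fun xs _ => Finset.sum_congr rfl fun as _ => ?_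
  simp only [trajProb_eq]
  rw [Finset.sum_eq_single (fun h => rew (xs h))]
  · simp
  · intro rs _ hrs
    simp [hrs]
  · simp

theorem valJ_nonneg {m : ℕ} (rew : Obs m → Bool) {π : Pol m} (hπ : validPol m π) :
    0 ≤ valJ m rew π := by
  rw [valJ_eq]
  refine Finset.sum_nonneg fun xs _ => Finset.sum_nonneg fun as _ =>
    mul_nonneg (pathProb_nonneg hπ _ _) (Finset.sum_nonneg fun h _ => ?_)
  split_ifs <;> norm_num

theorem hellSq_nonneg (m : ℕ) (rew rew' : Obs m → Bool) (π : Pol m) :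
    0 ≤ hellSq m rew rew' π :=
  Finset.sum_nonneg fun _ _ => Finset.sum_nonneg fun _ _ => Finset.sum_nonneg fun _ _ =>
    sq_nonneg _

theorem hellSq_le_two_mul_valJ {m : ℕ} (rew : Obs m → Bool) {π : Pol m}
    (hπ : validPol m π) : hellSq m rew (fun _ => false) π ≤ 2 * valJ m rew π := by
  rw [valJ_eq, hellSq, Finset.mul_sum]
  refine Finset.sum_le_sum fun xs _ => ?_
  rw [Finset.mul_sum]
  refine Finset.sum_le_sum fun as _ => ?_
  have hw := pathProb_nonneg hπ xs as
  simp only [trajProb_eq]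
  by_cases hz : (fun h => rew (xs h)) = fun _ => false
  · rw [hz]
    simp only [sub_self, ne_eq, OfNat.ofNat_ne_zero, not_false_eq_true, zero_pow,
      Finset.sum_const_zero]
    exact mul_nonneg zero_le_two (mul_nonneg hw
      (Finset.sum_nonneg fun h _ => by split_ifs <;> norm_num))
  · obtain ⟨h₀, hh₀⟩ : ∃ h, rew (xs h) = true := by
      by_contra! hne
      exact hz (funext fun h => by simpa using hne h)
    have hone : (1 : ℝ) ≤ ∑ h, (if rew (xs h) then (1 : ℝ) else 0) := by
      refine le_trans ?_ (Finset.single_le_sum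
        (f := fun h => if rew (xs h) then (1 : ℝ) else 0)
        (fun h _ => by split_ifs <;> norm_num) (Finset.mem_univ h₀))
      simp [hh₀]
    have hterm : ∀ rs : Fin (m + 1) → Bool,
        (Real.sqrt (if rs = (fun h => rew (xs h)) then pathProb m π xs as else 0)
          - Real.sqrt (if rs = (fun _ => false) then pathProb m π xs as else 0)) ^ 2
        = (if rs = (fun h => rew (xs h)) then pathProb m π xs as else 0)
          + (if rs = (fun _ => false) then pathProb m π xs as else 0) := by
      intro rs
      by_cases h1 : rs = fun h => rew (xs h)
      · have h2 : rs ≠ fun _ => false := fun h => hz (h1.symm.trans h)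
        rw [if_pos h1, if_neg h2]
        simp [Real.sq_sqrt hw]
      · by_cases h2 : rs = fun _ => false
        · rw [if_neg h1, if_pos h2]
          simp [Real.sq_sqrt hw]
        · rw [if_neg h1, if_neg h2]
          simp
    rw [Finset.sum_congr rfl fun rs _ => hterm rs, Finset.sum_add_distrib]
    simp only [Finset.sum_ite_eq', Finset.mem_univ, if_true]
    nlinarith

theorem sum_rewardOf_le_one (m : ℕ) (x : Obs m) :
    ∑ i, (if rewardOf m i x then (1 : ℝ) else 0) ≤ 1 := by
  rw [Finset.sum_boole]
  norm_cast
  rw [Finset.card_le_one]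
  intro i hi j hj
  have hi' : (x.2.val - 2 ^ m + i.val) % 2 ^ m = x.1.val := by
    by_contra hc
    simp [rewardOf, hc] at hi
  have hj' : (x.2.val - 2 ^ m + j.val) % 2 ^ m = x.1.val := by
    by_contra hc
    simp [rewardOf, hc] at hj
  have hmod : i.val ≡ j.val [MOD 2 ^ m] :=
    Nat.ModEq.add_left_cancel' (x.2.val - 2 ^ m) (hi'.trans hj'.symm)
  exact Fin.ext (hmod.eq_of_lt_of_lt i.2 j.2)

theorem rewardOf_of_lt {m : ℕ} (i : Fin (2 ^ m)) {x : Obs m} (hx : x.2.val < 2 ^ m) :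
    rewardOf m i x = false := by
  simp [rewardOf, Nat.not_le.mpr hx]

/-- A node reached at layer `h` (counted from zero) has heap index below `2 ^ (h + 1)`. -/
theorem heapIndex_lt {m : ℕ} {xs : Fin (m + 1) → Obs m} {as : Fin (m + 1) → Bool}
    (h0 : (xs 0).2.val = 1)
    (hs : ∀ h : Fin m, xs h.succ = step m (xs h.castSucc) (as h.castSucc))
    (h : Fin (m + 1)) : (xs h).2.val < 2 ^ (h.val + 1) := by
  induction h using Fin.induction with
  | zero => simp [h0]
  | succ h ih =>
    rw [hs h]
    refine (Nat.mod_le _ _).trans_lt ?_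
    simp only [Fin.val_castSucc, Fin.val_succ] at ih ⊢
    have hpow : 2 ^ (h.val + 1 + 1) = 2 ^ (h.val + 1) * 2 := pow_succ _ _
    split_ifs <;> omega

theorem sum_valJ_le_one {m : ℕ} {π : Pol m} (hπ : validPol m π) :
    ∑ i, valJ m (rewardOf m i) π ≤ 1 := by
  simp only [valJ_eq]
  refine le_trans ?_ (sum_pathProb hπ).le
  rw [Finset.sum_comm]
  refine Finset.sum_le_sum fun xs _ => ?_
  rw [Finset.sum_comm]
  refine Finset.sum_le_sum fun as _ => ?_
  rw [← Finset.mul_sum]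
  by_cases hd : (xs 0).2.val = 1
      ∧ ∀ h : Fin m, xs h.succ = step m (xs h.castSucc) (as h.castSucc)
  · refine mul_le_of_le_one_right (pathProb_nonneg hπ _ _) ?_
    refine le_trans (le_of_eq (Finset.sum_congr rfl fun i _ => ?_))
      (sum_rewardOf_le_one m (xs (Fin.last m)))
    rw [Fin.sum_univ_castSucc, Finset.sum_eq_zero, zero_add]
    intro h _
    have hlt : (xs h.castSucc).2.val < 2 ^ m :=
      (heapIndex_lt hd.1 hd.2 h.castSucc).trans_le
        (Nat.pow_le_pow_right two_pos (Nat.succ_le_of_lt h.2))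
    simp [rewardOf_of_lt i hlt]
  · simp [pathProb, hd]

theorem valJ_le_one {m : ℕ} (i : Fin (2 ^ m)) {π : Pol m} (hπ : validPol m π) :
    valJ m (rewardOf m i) π ≤ 1 :=
  (Finset.single_le_sum (f := fun i => valJ m (rewardOf m i) π)
    (fun _ _ => valJ_nonneg _ hπ) (Finset.mem_univ i)).trans (sum_valJ_le_one hπ)

theorem continuous_valJ (m : ℕ) (rew : Obs m → Bool) : Continuous (valJ m rew) := by
  unfold valJ
  refine continuous_finsetSum _ fun xs _ => continuous_finsetSum _ fun as _ =>
    continuous_finsetSum _ fun rs _ => Continuous.mul ?_ continuous_const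
  unfold trajProb
  split_ifs <;> fun_prop

theorem isClosed_validPol (m : ℕ) : IsClosed {π | validPol m π} := by
  simp only [validPol, Set.ofPred_and, Set.ofPred_forall]
  refine IsClosed.inter ?_ ?_
  · exact isClosed_iInter fun h => isClosed_iInter fun x => isClosed_iInter fun a =>
      isClosed_le continuous_const (by fun_prop)
  · exact isClosed_iInter fun h => isClosed_iInter fun x =>
      isClosed_eq (by fun_prop) continuous_const

theorem ae_validPol {m : ℕ} {μ : Measure (Pol m)} [IsProbabilityMeasure μ]
    (hμ : μ {π | validPol m π} = 1) : ∀ᵐ π ∂μ, validPol m π :=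
  (prob_compl_eq_zero_iff (isClosed_validPol m).measurableSet).mpr hμ

theorem integrable_valJ {m : ℕ} {μ : Measure (Pol m)} [IsProbabilityMeasure μ]
    (hμ : μ {π | validPol m π} = 1) (i : Fin (2 ^ m)) :
    Integrable (fun π => valJ m (rewardOf m i) π) μ := by
  refine Integrable.of_bound (continuous_valJ m _).aestronglyMeasurable 1 ?_
  filter_upwards [ae_validPol hμ] with π hπ
  rw [Real.norm_of_nonneg (valJ_nonneg _ hπ)]
  exact valJ_le_one i hπ

theorem sum_integral_valJ_le_one {m : ℕ} {μ : Measure (Pol m)} [IsProbabilityMeasure μ]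
    (hμ : μ {π | validPol m π} = 1) :
    ∑ i, ∫ π, valJ m (rewardOf m i) π ∂μ ≤ 1 := by
  rw [← integral_finsetSum _ fun i _ => integrable_valJ hμ i]
  calc ∫ π, ∑ i, valJ m (rewardOf m i) π ∂μ ≤ ∫ _, (1 : ℝ) ∂μ := by
        refine integral_mono_ae (integrable_finsetSum _ fun i _ => integrable_valJ hμ i)
          (integrable_const _) ?_
        filter_upwards [ae_validPol hμ] with π hπ
        exact sum_valJ_le_one hπ
    _ = 1 := by simp

theorem integral_hellSq_le {m : ℕ} {μ : Measure (Pol m)} [IsProbabilityMeasure μ]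
    (hμ : μ {π | validPol m π} = 1) (i : Fin (2 ^ m)) :
    ∫ π, hellSq m (rewardOf m i) (fun _ => false) π ∂μ
      ≤ 2 * ∫ π, valJ m (rewardOf m i) π ∂μ := by
  rw [← integral_const_mul]
  refine integral_mono_of_nonneg (Filter.Eventually.of_forall fun π => hellSq_nonneg _ _ _ π)
    ((integrable_valJ hμ i).const_mul 2) ?_
  filter_upwards [ae_validPol hμ] with π hπ
  exact hellSq_le_two_mul_valJ _ hπ

/-- Heap index of the leaf of tree `c` that carries the reward in `M^i`. -/
def goalLeaf (m : ℕ) (i c : Fin (2 ^ m)) : ℕ := 2 ^ m + (c - i).val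

theorem goalLeaf_lt (m : ℕ) (i c : Fin (2 ^ m)) : goalLeaf m i c < 2 ^ (m + 1) := by
  have := (c - i).2
  rw [goalLeaf, pow_succ]
  omega

/-- The action at layer `h` on the path from the root of tree `c` to the rewarding leaf. -/
def goalAction (m : ℕ) (i c : Fin (2 ^ m)) (h : Fin (m + 1)) : Bool :=
  decide (goalLeaf m i c / 2 ^ (m - (h.val + 1)) % 2 = 1)

/-- The node at layer `h` on the path from the root of tree `c` to the rewarding leaf. -/
def goalPath (m : ℕ) (i c : Fin (2 ^ m)) (h : Fin (m + 1)) : Obs m :=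
  (c, ⟨goalLeaf m i c / 2 ^ (m - h.val), (Nat.div_le_self _ _).trans_lt (goalLeaf_lt m i c)⟩)

/-- An optimal policy for `M^i`. -/
noncomputable def goalPol (m : ℕ) (i : Fin (2 ^ m)) : Pol m := fun h x a =>
  if a = goalAction m i x.1 h then 1 else 0

theorem validPol_goalPol (m : ℕ) (i : Fin (2 ^ m)) : validPol m (goalPol m i) := by
  refine ⟨fun h x a => ?_, fun h x => ?_⟩
  · unfold goalPol
    split_ifs <;> norm_num
  · simp [goalPol]

theorem goalPath_zero (m : ℕ) (i c : Fin (2 ^ m)) : (goalPath m i c 0).2.val = 1 := by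
  have := (c - i).2
  have : 0 < 2 ^ m := by positivity
  simp only [goalPath, goalLeaf, Fin.val_zero, Nat.sub_zero]
  rw [Nat.add_div_left _ this, Nat.div_eq_of_lt (c - i).2]

theorem goalPath_succ (m : ℕ) (i c : Fin (2 ^ m)) (h : Fin m) :
    goalPath m i c h.succ
      = step m (goalPath m i c h.castSucc) (goalAction m i c h.castSucc) := by
  refine Prod.ext rfl (Fin.ext ?_)
  simp only [goalPath, step, goalAction, Fin.val_succ, Fin.val_castSucc, decide_eq_true_eq]
  have he : m - h.val = m - (h.val + 1) + 1 := by omega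
  rw [he, pow_succ, ← Nat.div_div_eq_div_mul]
  have hlt : goalLeaf m i c / 2 ^ (m - (h.val + 1)) < 2 ^ (m + 1) :=
    (Nat.div_le_self _ _).trans_lt (goalLeaf_lt m i c)
  have hsum : 2 * (goalLeaf m i c / 2 ^ (m - (h.val + 1)) / 2)
      + (if goalLeaf m i c / 2 ^ (m - (h.val + 1)) % 2 = 1 then 1 else 0)
      = goalLeaf m i c / 2 ^ (m - (h.val + 1)) := by
    split_ifs <;> omega
  rw [hsum, Nat.mod_eq_of_lt hlt]

theorem rewardOf_goalPath_last (m : ℕ) (i c : Fin (2 ^ m)) :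
    rewardOf m i (goalPath m i c (Fin.last m)) = true := by
  have hci : (c - i).val + i.val ≡ c.val [MOD 2 ^ m] := by
    have : ((c - i + i : Fin (2 ^ m))).val = c.val := by rw [sub_add_cancel]
    rw [Fin.val_add] at this
    rw [Nat.ModEq, this, Nat.mod_eq_of_lt c.2]
  simp only [rewardOf, goalPath, goalLeaf, Fin.val_last, Nat.sub_self, pow_zero, Nat.div_one,
    Nat.add_sub_cancel_left, Nat.le_add_right, true_and]
  rw [if_pos (Eq.trans hci (Nat.mod_eq_of_lt c.2))]

theorem one_le_valJ_goalPol (m : ℕ) (i : Fin (2 ^ m)) :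
    1 ≤ valJ m (rewardOf m i) (goalPol m i) := by
  rw [valJ_eq, ← Fintype.sum_prod_type']
  have hnn : ∀ z : (Fin (m + 1) → Obs m) × (Fin (m + 1) → Bool),
      0 ≤ pathProb m (goalPol m i) z.1 z.2
        * ∑ h, (if rewardOf m i (z.1 h) then (1 : ℝ) else 0) := fun z =>
    mul_nonneg (pathProb_nonneg (validPol_goalPol m i) _ _)
      (Finset.sum_nonneg fun h _ => by split_ifs <;> norm_num)
  have hinj : Function.Injective
      fun c : Fin (2 ^ m) => (goalPath m i c, goalAction m i c) := fun c d hcd =>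
    congrArg Prod.fst (congrFun (congrArg Prod.fst hcd) 0)
  refine le_trans ?_ (Finset.sum_le_univ_sum_of_nonneg hnn
    (s := Finset.univ.map ⟨_, hinj⟩))
  rw [Finset.sum_map]
  have hterm : ∀ c : Fin (2 ^ m), 1 / (2 ^ m : ℝ) ≤
      pathProb m (goalPol m i) (goalPath m i c) (goalAction m i c)
        * ∑ h, (if rewardOf m i (goalPath m i c h) then (1 : ℝ) else 0) := by
    intro c
    have hp : pathProb m (goalPol m i) (goalPath m i c) (goalAction m i c)
        = 1 / (2 ^ m : ℝ) := by
      rw [pathProb, if_pos ⟨goalPath_zero m i c, goalPath_succ m i c⟩]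
      simp [goalPol, goalPath]
    rw [hp]
    refine le_mul_of_one_le_right (by positivity) ?_
    refine le_trans ?_ (Finset.single_le_sum
      (f := fun h => if rewardOf m i (goalPath m i c h) then (1 : ℝ) else 0)
      (fun h _ => by split_ifs <;> norm_num) (Finset.mem_univ (Fin.last m)))
    simp [rewardOf_goalPath_last]
  refine le_trans (le_of_eq ?_) (Finset.sum_le_sum fun c _ => hterm c)
  simp

theorem one_le_sSup_valJ (m : ℕ) (i : Fin (2 ^ m)) :
    1 ≤ sSup ((fun π => valJ m (rewardOf m i) π) '' {π | validPol m π}) := by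
  refine (one_le_valJ_goalPol m i).trans (le_csSup ⟨1, ?_⟩ ⟨_, validPol_goalPol m i, rfl⟩)
  rintro _ ⟨π, hπ, rfl⟩
  exact valJ_le_one i hπ

/-- For the tree construction with `N = 2^m ≥ 4` trees (`H = m+1`),
the constrained PAC Decision-Estimation Coefficient of the class
`M = {M^i : i ∈ [N]}` relative to the zero-reward reference MDP `M̄` satisfies
`dec_ε(M, M̄) ≥ 1/2` whenever `ε² ≥ 4/N`; unfolding the definition
`dec_ε(M, M̄) = inf_{p,q ∈ Δ(Π)} sup { E_{π∼p}[J^M(π_M) − J^M(π)] :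
M ∈ M, E_{π∼q}[D²_H(M(π), M̄(π))] ≤ ε² }`, this says: for all probability
distributions `p, q` over the set of randomized non-stationary policies there is an
index `i` such that `M^i` satisfies the Hellinger constraint under `q` while the
`p`-average suboptimality in `M^i` is at least `1/2` (with `J^{M^i}(π_{M^i})` the
optimal value `sup_π J^{M^i}(π)`). -/
theorem statement19 (m : ℕ) (hm : 2 ≤ m) (ε : ℝ)
    (hε : 4 / (2 ^ m : ℝ) ≤ ε ^ 2)
    (p q : Measure (Pol m)) [IsProbabilityMeasure p] [IsProbabilityMeasure q]
    (hp : p {π | validPol m π} = 1) (hq : q {π | validPol m π} = 1) :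
    ∃ i : Fin (2 ^ m),
      (∫ π, hellSq m (rewardOf m i) (fun _ => false) π ∂q ≤ ε ^ 2)
      ∧ (1 / 2 : ℝ) ≤
          sSup ((fun π => valJ m (rewardOf m i) π) '' {π | validPol m π})
            - ∫ π, valJ m (rewardOf m i) π ∂p := by
  by_contra! hbad
  have hN : (4 : ℝ) ≤ 2 ^ m := by
    calc (4 : ℝ) = 2 ^ 2 := by norm_num
      _ ≤ 2 ^ m := pow_le_pow_right₀ one_le_two hm
  have hterm : ∀ i : Fin (2 ^ m), (1 : ℝ) <
      2 ^ m / 2 * ∫ π, valJ m (rewardOf m i) π ∂q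
        + 2 * ∫ π, valJ m (rewardOf m i) π ∂p := by
    intro i
    have hq0 : 0 ≤ ∫ π, valJ m (rewardOf m i) π ∂q :=
      integral_nonneg_of_ae ((ae_validPol hq).mono fun π hπ => valJ_nonneg _ hπ)
    have hp0 : 0 ≤ ∫ π, valJ m (rewardOf m i) π ∂p :=
      integral_nonneg_of_ae ((ae_validPol hp).mono fun π hπ => valJ_nonneg _ hπ)
    have hq0' := mul_nonneg (by positivity : (0 : ℝ) ≤ 2 ^ m / 2) hq0
    by_cases hc : ∫ π, hellSq m (rewardOf m i) (fun _ => false) π ∂q ≤ ε ^ 2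
    · have h1 := hbad i hc
      have h2 := one_le_sSup_valJ m i
      linarith
    · have h1 := hε.trans_lt ((not_le.mp hc).trans_le (integral_hellSq_le hq i))
      rw [div_lt_iff₀ (by positivity)] at h1
      nlinarith
  have hlt := Finset.sum_lt_sum_of_nonempty (s := Finset.univ)
    (Finset.univ_nonempty (α := Fin (2 ^ m))) fun i _ => hterm i
  rw [Finset.sum_add_distrib, ← Finset.mul_sum, ← Finset.mul_sum] at hlt
  have hq1 := mul_le_mul_of_nonneg_left (sum_integral_valJ_le_one hq)
    (by positivity : (0 : ℝ) ≤ 2 ^ m / 2)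
  have hp1 := sum_integral_valJ_le_one hp
  simp only [Finset.sum_const, Finset.card_univ, Fintype.card_fin, nsmul_eq_mul, Nat.cast_pow,
    Nat.cast_ofNat, mul_one] at hlt hq1
  linarith

end TreeLB
end
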